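/- arXiv:2506.12999 — 2 statements merged into one kernel-verified Lean document; each statement's English description precedes it below -/
import Mathlib

section
/- Let ℓ be a prime and K a number field containing the ℓ-th roots of unity. Let γ ∈ 𝒪_K be nonzero with L = K(γ^{1/ℓ}) of degree ℓ over K. Factor γ𝒪_K = Q · 𝔯^ℓ · ∏_{i=1}^{ℓ−1} 𝔍_i^i, where Q is the ℓ-part of γ𝒪_K, 𝔯^ℓ is the ℓ-power-part of γ𝒪_K, and for each 1 ≤ i ≤ ℓ−1, 𝔍_i is the squarefree product of the primes p ∤ ℓ𝒪_K with v_p(γ𝒪_K) ≡ i (mod ℓ) taken away from the ℓ-power part (so the 𝔍_i are pairwise coprime squarefree ideals coprime to ℓ𝒪_K). Then the fractional ideal 𝔏_{L/K} / (Q 𝔯^ℓ ∏_{i=2}^{ℓ−1} 𝔍_i^{i−1})^{ℓ−1} is the square of a fractional ideal of K, and the square of the Steinitz class St(𝒪_L) in Cl(K) equals the class of this fractional ideal; equivalently, St(𝒪_L) is the class of its unique square root. -/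
open NumberField Filter
open scoped nonZeroDivisors

noncomputable section

/-- The relative discriminant ideal of `L/K`. -/
def relDisc (K L : Type*) [Field K] [NumberField K] [Field L] [Algebra K L] :
    Ideal (𝓞 K) :=
  Ideal.span {d : 𝓞 K | ∃ b : Module.Basis (Fin (Module.finrank K L)) K L,
    (∀ i, IsIntegral ℤ (b i)) ∧ algebraMap (𝓞 K) K d = Algebra.discr K ⇑b}

/-- `c` is the Steinitz class of `L/K`. -/
def IsSteinitzClass (K : Type*) [Field K] [NumberField K] (L : Type*) [Field L]
    [Algebra K L] (c : ClassGroup (𝓞 K)) : Prop :=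
  ∃ I : (Ideal (𝓞 K))⁰, ClassGroup.mk0 I = c ∧
    Nonempty ((𝓞 L) ≃ₗ[𝓞 K] ((Fin (Module.finrank K L - 1) → 𝓞 K) × (I : Ideal (𝓞 K))))

theorem Ideal.span_image_sq {R : Type*} [CommRing R] [IsDedekindDomain R] (S : Set R) :
    Ideal.span ((· ^ 2) '' S) = Ideal.span S ^ 2 := by
  have pair : ∀ s t : R, Ideal.span {s ^ 2, t ^ 2} = Ideal.span {s, t} ^ 2 := by
    intro s t
    by_cases h : Ideal.span {s, t} = ⊥
    · have hs : s = 0 := by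
        simpa [h] using Ideal.subset_span (show s ∈ ({s, t} : Set R) by simp)
      have ht : t = 0 := by
        simpa [h] using Ideal.subset_span (show t ∈ ({s, t} : Set R) by simp)
      subst hs ht
      simp
    · refine mul_left_cancel₀ h ?_
      have hmul : ∀ a ∈ ({s, t} : Set R), ∀ b ∈ ({s ^ 2, t ^ 2} : Set R), ∀ c : R, c = a * b →
          c ∈ Ideal.span {s, t} * Ideal.span {s ^ 2, t ^ 2} := by
        rintro a ha b hb _ rfl
        exact Ideal.mul_mem_mul (Ideal.subset_span ha) (Ideal.subset_span hb)
      apply le_antisymm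
      · refine Ideal.mul_mono_right ?_
        rw [Ideal.span_le]
        rintro _ (rfl | rfl) <;>
        exact Ideal.pow_mem_pow (Ideal.subset_span (by simp)) 2
      · rw [pow_two (Ideal.span {s, t}), Ideal.span_pair_mul_span_pair, Ideal.span_mul_span',
          Ideal.span_le]
        rintro _ ⟨a, rfl | rfl, b, rfl | rfl | rfl | rfl, rfl⟩
        · exact hmul a (by simp) (a ^ 2) (by simp) _ (by ring)
        · exact hmul t (by simp) (a ^ 2) (by simp) _ (by ring)
        · exact hmul t (by simp) (a ^ 2) (by simp) _ (by ring)
        · exact hmul a (by simp) (t ^ 2) (by simp) _ (by ring)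
        · exact hmul a (by simp) (s ^ 2) (by simp) _ (by ring)
        · exact hmul s (by simp) (a ^ 2) (by simp) _ (by ring)
        · exact hmul s (by simp) (a ^ 2) (by simp) _ (by ring)
        · exact hmul a (by simp) (a ^ 2) (by simp) _ (by ring)
  apply le_antisymm
  · rw [Ideal.span_le]
    rintro _ ⟨s, hs, rfl⟩
    exact Ideal.pow_mem_pow (Ideal.subset_span hs) 2
  · rw [pow_two, Ideal.span_mul_span', Ideal.span_le]
    rintro _ ⟨s, hs, t, ht, rfl⟩
    have hst : s * t ∈ Ideal.span {s ^ 2, t ^ 2} := by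
      rw [pair, pow_two]
      exact Ideal.mul_mem_mul (Ideal.subset_span (by simp)) (Ideal.subset_span (by simp))
    refine Ideal.span_mono ?_ hst
    rintro _ (rfl | rfl)
    exacts [⟨s, hs, rfl⟩, ⟨t, ht, rfl⟩]

theorem IsPrimitiveRoot.associated_natCast_sub_one_pow {R : Type*} [CommRing R] [IsDomain R]
    {p : ℕ} (hp : p.Prime) {ζ : R} (hζ : IsPrimitiveRoot ζ p) :
    Associated (p : R) ((ζ - 1) ^ (p - 1)) := by
  obtain ⟨n, rfl⟩ : ∃ n, p = n + 1 := ⟨p - 1, by have := hp.pos; omega⟩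
  have h := hζ.prod_one_sub_pow_eq_order
  rw [Nat.cast_add, Nat.cast_one, ← h, Nat.add_sub_cancel]
  have : ((ζ - 1) ^ n) = ∏ k ∈ Finset.range n, (ζ - 1) := by simp
  rw [this]
  apply Associated.prod
  intro k hk
  rw [Finset.mem_range] at hk
  rw [← neg_sub, Associated.neg_left_iff]
  refine (hζ.associated_sub_one_pow_sub_one_of_coprime ?_).symm
  exact (Nat.coprime_of_lt_prime (by omega) (by omega) hp).symm

theorem IsPrimitiveRoot.exists_sq_associated_natCast_pow {R : Type*} [CommRing R] [IsDomain R]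
    {p : ℕ} (hp : p.Prime) {ζ : R} (hζ : IsPrimitiveRoot ζ p) :
    ∃ s : R, Associated ((p : R) ^ p) (s ^ 2) := by
  refine ⟨(ζ - 1) ^ (p * (p - 1) / 2), ?_⟩
  rw [← pow_mul, Nat.div_mul_cancel (Nat.even_mul_pred_self p).two_dvd, mul_comm p, pow_mul]
  exact (hζ.associated_natCast_sub_one_pow hp).pow_pow

theorem relDisc_eq_span {K L : Type*} [Field K] [NumberField K] [Field L] [Algebra K L] {n : ℕ}
    (h : Module.finrank K L = n) :
    relDisc K L = Ideal.span {d : 𝓞 K | ∃ b : Module.Basis (Fin n) K L,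
      (∀ i, IsIntegral ℤ (b i)) ∧ algebraMap (𝓞 K) K d = Algebra.discr K ⇑b} := by
  subst h
  rfl

theorem Module.Basis.discr_eq_det_sq_mul {K L ι : Type*} [Field K] [Field L] [Algebra K L]
    [Fintype ι] [DecidableEq ι] (B : Module.Basis ι K L) (b : ι → L) :
    Algebra.discr K b = B.det b ^ 2 * Algebra.discr K B := by
  rw [Module.Basis.det_apply, ← Algebra.discr_of_matrix_vecMul]
  congr 1
  ext j
  simp only [Matrix.vecMul, dotProduct, Matrix.map_apply, Module.Basis.toMatrix_apply]
  conv_lhs => rw [← B.sum_repr (b j)]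
  simp [Algebra.smul_def, mul_comm]

/-- The ideal generated by the determinants, scaled by `N`, of the families of integers of `L`
with respect to the `K`-basis `B` of `L`. -/
def detIdeal {K L : Type*} [Field K] [Field L] [Algebra K L] {n : ℕ}
    (B : Module.Basis (Fin n) K L) (N : 𝓞 K) : Ideal (𝓞 K) :=
  Ideal.span {a : 𝓞 K | ∃ b : Fin n → L, (∀ i, IsIntegral ℤ (b i)) ∧
    algebraMap (𝓞 K) K a = algebraMap (𝓞 K) K N * B.det b}

theorem span_sq_mul_relDisc {K L : Type*} [Field K] [NumberField K] [Field L] [Algebra K L] {n : ℕ}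
    (B : Module.Basis (Fin n) K L) {N D : 𝓞 K}
    (hden : ∀ b : Fin n → L, (∀ i, IsIntegral ℤ (b i)) →
      ∃ a : 𝓞 K, algebraMap (𝓞 K) K a = algebraMap (𝓞 K) K N * B.det b)
    (hD : algebraMap (𝓞 K) K D = Algebra.discr K B) :
    Ideal.span {N} ^ 2 * relDisc K L = Ideal.span {D} * detIdeal B N ^ 2 := by
  have hn : Module.finrank K L = n := by simpa using Module.finrank_eq_card_basis B
  have hinj := FaithfulSMul.algebraMap_injective (𝓞 K) K
  rw [relDisc_eq_span hn, detIdeal, Ideal.span_singleton_pow, ← Ideal.span_image_sq,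
    Ideal.span_mul_span', Ideal.span_mul_span']
  apply le_antisymm <;> rw [Ideal.span_le]
  · rintro _ ⟨_, rfl, d, ⟨b, hb, hd⟩, rfl⟩
    obtain ⟨a, ha⟩ := hden b hb
    refine Ideal.subset_span ⟨D, rfl, a ^ 2, ⟨a, ⟨b, hb, ha⟩, rfl⟩, hinj ?_⟩
    simp only [map_mul, map_pow, ha, hD, hd, B.discr_eq_det_sq_mul b]
    ring
  · rintro _ ⟨_, rfl, _, ⟨a, ⟨b, hb, ha⟩, rfl⟩, rfl⟩
    by_cases h0 : a = 0
    · simp [h0]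
    have hdet : B.det b ≠ 0 := by
      intro h
      rw [h, mul_zero] at ha
      exact h0 (hinj (by simpa using ha))
    obtain ⟨hli, hsp⟩ := B.is_basis_iff_det.mpr hdet.isUnit
    let b' := Module.Basis.mk hli hsp.ge
    have hb' : ⇑b' = b := Module.Basis.coe_mk _ _
    obtain ⟨d, hd⟩ : ∃ d : 𝓞 K, algebraMap (𝓞 K) K d = Algebra.discr K b := by
      have : FiniteDimensional K L := Module.Finite.of_basis B
      exact ⟨⟨_, Algebra.discr_isIntegral K hb⟩, rfl⟩
    refine Ideal.subset_span ⟨_, rfl, d, ⟨b', by simpa [hb'] using hb, by rw [hb', hd]⟩, hinj ?_⟩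
    simp only [map_mul, map_pow, ha, hD, hd, B.discr_eq_det_sq_mul b]
    ring

theorem Module.Basis.det_eq_det_mul_det {R M ι : Type*} [CommRing R] [AddCommGroup M] [Module R M]
    [Fintype ι] [DecidableEq ι] (B E : Module.Basis ι R M) (b : ι → M) :
    B.det b = B.det E * E.det b := by
  simp only [Module.Basis.det_apply]
  rw [← Matrix.det_mul, B.toMatrix_mul_toMatrix]

theorem Matrix.det_mem_of_row_mem {R ι : Type*} [CommRing R] [Fintype ι] [DecidableEq ι]
    (I : Ideal R) (M : Matrix ι ι R) (i : ι) (h : ∀ j, M i j ∈ I) : M.det ∈ I := by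
  rw [Matrix.det_apply]
  refine Ideal.sum_mem _ fun σ _ => ?_
  rw [Units.smul_def, zsmul_eq_mul]
  refine I.mul_mem_left _ (I.mem_of_dvd (Finset.dvd_prod_of_mem _ (Finset.mem_univ (σ⁻¹ i))) ?_)
  simpa using h _

section Steinitz

variable {K L : Type*} [Field K] [Field L] [Algebra K L] {m : ℕ}
  {I : Ideal (𝓞 K)}

/-- The family of integers of `L` given by the unit vectors of the free part of
`𝓞 L ≃ (𝓞 K)ᵐ × I`, followed by the image of `i₀ ∈ I`. -/
def steinitzFamily (φ : 𝓞 L ≃ₗ[𝓞 K] ((Fin m → 𝓞 K) × I)) (i₀ : I) : Fin (m + 1) → L :=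
  Fin.snoc (α := fun _ => L) (fun j => algebraMap (𝓞 L) L (φ.symm (Pi.single j 1, 0)))
    (algebraMap (𝓞 L) L (φ.symm (0, i₀)))

/-- The coordinates of `y` with respect to `steinitzFamily φ i₀`. -/
def steinitzCoord (φ : 𝓞 L ≃ₗ[𝓞 K] ((Fin m → 𝓞 K) × I)) (i₀ : I) (y : 𝓞 L) : Fin (m + 1) → K :=
  Fin.snoc (α := fun _ => K) (fun j => algebraMap (𝓞 K) K ((φ y).1 j))
    (algebraMap (𝓞 K) K (φ y).2 / algebraMap (𝓞 K) K i₀)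

theorem isIntegral_steinitzFamily (φ : 𝓞 L ≃ₗ[𝓞 K] ((Fin m → 𝓞 K) × I)) (i₀ : I)
    (j : Fin (m + 1)) : IsIntegral ℤ (steinitzFamily φ i₀ j) := by
  induction j using Fin.lastCases with
  | last => simpa [steinitzFamily] using RingOfIntegers.isIntegral_coe (K := L) _
  | cast j => simpa [steinitzFamily] using RingOfIntegers.isIntegral_coe (K := L) _

theorem coe_smul_ringOfIntegers (a : 𝓞 K) (y : 𝓞 L) :
    algebraMap (𝓞 L) L (a • y) = algebraMap (𝓞 K) K a • algebraMap (𝓞 L) L y := by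
  rw [Algebra.smul_def, Algebra.smul_def]
  rfl

theorem coe_symm_eq_div_smul (φ : 𝓞 L ≃ₗ[𝓞 K] ((Fin m → 𝓞 K) × I)) {i₀ : I} (h₀ : i₀ ≠ 0) (i : I) :
    algebraMap (𝓞 L) L (φ.symm (0, i)) =
      (algebraMap (𝓞 K) K i / algebraMap (𝓞 K) K i₀) •
        algebraMap (𝓞 L) L (φ.symm (0, i₀)) := by
  have h0 : algebraMap (𝓞 K) K i₀ ≠ 0 := by simpa using h₀
  have h : (i₀ : 𝓞 K) • φ.symm (0, i) = (i : 𝓞 K) • φ.symm (0, i₀) := by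
    rw [← map_smul, ← map_smul]
    congr 1
    ext
    · simp
    · simp [mul_comm]
  have h' := congrArg (algebraMap (𝓞 L) L) h
  simp only [coe_smul_ringOfIntegers] at h'
  rw [div_eq_inv_mul, mul_smul, ← h', inv_smul_smul₀ h0]

theorem sum_steinitzCoord_smul (φ : 𝓞 L ≃ₗ[𝓞 K] ((Fin m → 𝓞 K) × I)) {i₀ : I} (h₀ : i₀ ≠ 0)
    (y : 𝓞 L) : ∑ j, steinitzCoord φ i₀ y j • steinitzFamily φ i₀ j = algebraMap (𝓞 L) L y := by
  have hy : y = ∑ j, (φ y).1 j • φ.symm (Pi.single j 1, 0) + φ.symm (0, (φ y).2) := by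
    apply φ.injective
    simp only [map_add, map_sum, map_smul, LinearEquiv.apply_symm_apply]
    ext j
    · simp [Prod.fst_sum, Finset.sum_apply, Pi.single_apply]
    · simp [Prod.snd_sum]
  rw [Fin.sum_univ_castSucc]
  conv_rhs => rw [hy]
  simp only [steinitzCoord, steinitzFamily, Fin.snoc_castSucc, Fin.snoc_last]
  rw [← coe_symm_eq_div_smul φ h₀, map_add, map_sum]
  simp [coe_smul_ringOfIntegers]

/-- `steinitzFamily φ i₀` is a `K`-basis of `L`. -/
theorem exists_basis_eq_steinitzFamily [NumberField K] (hfin : Module.finrank K L = m + 1)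
    (φ : 𝓞 L ≃ₗ[𝓞 K] ((Fin m → 𝓞 K) × I)) {i₀ : I} (h₀ : i₀ ≠ 0) :
    ∃ E : Module.Basis (Fin (m + 1)) K L, ⇑E = steinitzFamily φ i₀ := by
  have : FiniteDimensional K L := Module.finite_of_finrank_eq_succ hfin
  have hsp : ⊤ ≤ Submodule.span K (Set.range (steinitzFamily φ i₀)) := by
    intro z _
    obtain ⟨d, hd⟩ := IsIntegral.exists_multiple_integral_of_isLocalization (𝓞 K)⁰ z
      (Algebra.IsIntegral.isIntegral (R := K) z)
    have hd' : IsIntegral ℤ (d • z) := isIntegral_trans (A := 𝓞 K) _ hd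
    have hd0 : algebraMap (𝓞 K) K d ≠ 0 := by simp
    obtain ⟨w, hw⟩ : ∃ w : 𝓞 L, algebraMap (𝓞 L) L w = algebraMap (𝓞 K) K d • z :=
      ⟨⟨_, hd'⟩, (IsScalarTower.algebraMap_smul K (d : 𝓞 K) z).symm⟩
    rw [← inv_smul_smul₀ hd0 z, ← hw, ← sum_steinitzCoord_smul φ h₀]
    exact Submodule.smul_mem _ _ (Submodule.sum_mem _ fun j _ =>
      Submodule.smul_mem _ _ (Submodule.subset_span ⟨j, rfl⟩))
  exact ⟨basisOfTopLeSpanOfCardEqFinrank _ hsp (by simp [hfin]),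
    coe_basisOfTopLeSpanOfCardEqFinrank _ _ _⟩

theorem exists_mem_det_steinitzFamily (φ : 𝓞 L ≃ₗ[𝓞 K] ((Fin m → 𝓞 K) × I)) {i₀ : I} (h₀ : i₀ ≠ 0)
    (E : Module.Basis (Fin (m + 1)) K L) (hE : ⇑E = steinitzFamily φ i₀) (b : Fin (m + 1) → L)
    (hb : ∀ j, IsIntegral ℤ (b j)) :
    ∃ i ∈ I, algebraMap (𝓞 K) K i = algebraMap (𝓞 K) K i₀ * E.det b := by
  have h0 : algebraMap (𝓞 K) K i₀ ≠ 0 := by simpa using h₀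
  let y : Fin (m + 1) → 𝓞 L := fun j => ⟨b j, hb j⟩
  have hrepr : ∀ j, E.repr (b j) = steinitzCoord φ i₀ (y j) := by
    intro j
    have h := sum_steinitzCoord_smul φ h₀ (y j)
    rw [← hE] at h
    change _ = b j at h
    rw [← h, E.repr_sum_self]
  let M : Matrix (Fin (m + 1)) (Fin (m + 1)) (𝓞 K) := fun i j =>
    Fin.snoc (α := fun _ => 𝓞 K) (φ (y j)).1 ((φ (y j)).2 : 𝓞 K) i
  refine ⟨M.det, Matrix.det_mem_of_row_mem I M (Fin.last m) (by simp [M]), ?_⟩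
  have hM : M.map (algebraMap (𝓞 K) K) =
      (E.toMatrix b).updateRow (Fin.last m)
        (algebraMap (𝓞 K) K i₀ • E.toMatrix b (Fin.last m)) := by
    ext i j
    induction i using Fin.lastCases with
    | last =>
      rw [Matrix.map_apply, Matrix.updateRow_self, Pi.smul_apply, smul_eq_mul,
        Module.Basis.toMatrix_apply, hrepr]
      simp only [M, steinitzCoord, Fin.snoc_last, mul_div_cancel₀ _ h0]
    | cast i =>
      rw [Matrix.map_apply, Matrix.updateRow_ne (Fin.castSucc_lt_last i).ne,
        Module.Basis.toMatrix_apply, hrepr]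
      simp only [M, steinitzCoord, Fin.snoc_castSucc]
  rw [RingHom.map_det, RingHom.mapMatrix_apply, hM, Matrix.det_updateRow_smul,
    Matrix.updateRow_eq_self, Module.Basis.det_apply]

theorem exists_det_steinitzFamily_eq (φ : 𝓞 L ≃ₗ[𝓞 K] ((Fin m → 𝓞 K) × I)) {i₀ : I} (h₀ : i₀ ≠ 0)
    (E : Module.Basis (Fin (m + 1)) K L) (hE : ⇑E = steinitzFamily φ i₀) (i : I) :
    ∃ b : Fin (m + 1) → L, (∀ j, IsIntegral ℤ (b j)) ∧
      algebraMap (𝓞 K) K i = algebraMap (𝓞 K) K i₀ * E.det b := by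
  have h0 : algebraMap (𝓞 K) K i₀ ≠ 0 := by simpa using h₀
  refine ⟨Function.update E (Fin.last m) (algebraMap (𝓞 L) L (φ.symm (0, i))), fun j => ?_, ?_⟩
  · by_cases hj : j = Fin.last m
    · subst hj
      simpa using RingOfIntegers.isIntegral_coe (K := L) _
    · rw [Function.update_of_ne hj, hE]
      exact isIntegral_steinitzFamily φ i₀ j
  · have hlast : algebraMap (𝓞 L) L (φ.symm (0, i₀)) = E (Fin.last m) := by
      simp [hE, steinitzFamily]
    rw [coe_symm_eq_div_smul φ h₀, hlast, AlternatingMap.map_update_smul, Function.update_eq_self,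
      E.det_self, smul_eq_mul, mul_one, mul_div_cancel₀ _ h0]

theorem exists_span_mul_detIdeal_eq [NumberField K] (B : Module.Basis (Fin (m + 1)) K L)
    {N : 𝓞 K} (hN : N ≠ 0)
    (hden : ∀ b : Fin (m + 1) → L, (∀ i, IsIntegral ℤ (b i)) →
      ∃ a : 𝓞 K, algebraMap (𝓞 K) K a = algebraMap (𝓞 K) K N * B.det b)
    (φ : 𝓞 L ≃ₗ[𝓞 K] ((Fin m → 𝓞 K) × I)) (hI : I ≠ ⊥) :
    ∃ s t : 𝓞 K, s ≠ 0 ∧ t ≠ 0 ∧ Ideal.span {s} * detIdeal B N = Ideal.span {t} * I := by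
  have hinj := FaithfulSMul.algebraMap_injective (𝓞 K) K
  obtain ⟨i, hi, hi0⟩ := Submodule.exists_mem_ne_zero_of_ne_bot hI
  let i₀ : I := ⟨i, hi⟩
  have h₀ : i₀ ≠ 0 := by simpa [i₀] using hi0
  obtain ⟨E, hE⟩ := exists_basis_eq_steinitzFamily
    (by simpa using Module.finrank_eq_card_basis B) φ h₀
  obtain ⟨a₀, ha₀⟩ := hden E (by rw [hE]; exact isIntegral_steinitzFamily φ i₀)
  have hdet : B.det E ≠ 0 := (B.isUnit_det E).ne_zero
  refine ⟨i, a₀, hi0, ?_, ?_⟩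
  · rintro rfl
    have : algebraMap (𝓞 K) K N ≠ 0 := by simpa using hN
    simp [this, hdet] at ha₀
  apply le_antisymm
  · rw [detIdeal, Ideal.span_mul_span', Ideal.span_le]
    rintro _ ⟨i', hi', a, ⟨b, hb, ha⟩, rfl⟩
    rw [Set.mem_singleton_iff.mp hi']
    obtain ⟨k, hk, hk'⟩ := exists_mem_det_steinitzFamily φ h₀ E hE b hb
    have : i * a = a₀ * k := by
      apply hinj
      rw [map_mul, map_mul, ha, ha₀, show algebraMap (𝓞 K) K k = _ from hk',
        B.det_eq_det_mul_det E b]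
      ring
    change i * a ∈ _
    rw [this]
    exact Ideal.mul_mem_mul (Ideal.mem_span_singleton_self _) hk
  · rw [Ideal.span_singleton_mul_le_iff]
    intro k hk
    obtain ⟨b, hb, hb'⟩ := exists_det_steinitzFamily_eq φ h₀ E hE ⟨k, hk⟩
    obtain ⟨a, ha⟩ := hden b hb
    have : a₀ * k = i * a := by
      apply hinj
      rw [map_mul, map_mul, ha, ha₀, show algebraMap (𝓞 K) K k = _ from hb',
        B.det_eq_det_mul_det E b]
      ring
    rw [this]
    exact Ideal.mul_mem_mul (Ideal.mem_span_singleton_self _) (Ideal.subset_span ⟨b, hb, ha⟩)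

end Steinitz

theorem IsSteinitzClass.eq_mk0_of_eq_detIdeal {K L : Type*} [Field K] [NumberField K] [Field L]
    [Algebra K L] {n : ℕ} (hn : 0 < n) (B : Module.Basis (Fin n) K L) {N : 𝓞 K} (hN : N ≠ 0)
    (hden : ∀ b : Fin n → L, (∀ i, IsIntegral ℤ (b i)) →
      ∃ a : 𝓞 K, algebraMap (𝓞 K) K a = algebraMap (𝓞 K) K N * B.det b)
    {c : ClassGroup (𝓞 K)} (hc : IsSteinitzClass K L c) (A : (Ideal (𝓞 K))⁰)
    (hA : (A : Ideal (𝓞 K)) = detIdeal B N) : c = ClassGroup.mk0 A := by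
  obtain ⟨m, rfl⟩ : ∃ m, n = m + 1 := ⟨n - 1, by omega⟩
  have hfin : Module.finrank K L = m + 1 := by simpa using Module.finrank_eq_card_basis B
  obtain ⟨I, rfl, ⟨φ⟩⟩ := hc
  rw [hfin, Nat.add_sub_cancel] at φ
  obtain ⟨s, t, hs, ht, h⟩ := exists_span_mul_detIdeal_eq B hN hden φ (nonZeroDivisors.ne_zero I.2)
  exact ClassGroup.mk0_eq_mk0_iff.mpr ⟨t, s, ht, hs, by rw [hA, h]⟩

section Kummer

open Polynomial in
theorem exists_powerBasis_of_pow_eq {K L : Type*} [Field K] [Field L] [Algebra K L] {n : ℕ}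
    (hn : 0 < n) {g : K} {x : L} (hx : x ^ n = algebraMap K L g)
    (hgen : IntermediateField.adjoin K {x} = ⊤) (hdeg : Module.finrank K L = n) :
    ∃ pb : PowerBasis K L, pb.gen = x ∧ pb.dim = n ∧ minpoly K x = X ^ n - C g := by
  have : FiniteDimensional K L := Module.finite_of_finrank_pos (by omega)
  have hint : IsIntegral K x := Algebra.IsIntegral.isIntegral x
  have htop : Algebra.adjoin K {x} = ⊤ := by
    rw [← IntermediateField.adjoin_simple_toSubalgebra_of_isAlgebraic hint.isAlgebraic, hgen,
      IntermediateField.top_toSubalgebra]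
  let pb := PowerBasis.ofAdjoinEqTop hint htop
  have hpb : pb.gen = x := PowerBasis.ofAdjoinEqTop_gen hint htop
  have hdim : pb.dim = n := by rw [← pb.finrank, hdeg]
  refine ⟨pb, hpb, hdim, ?_⟩
  refine (eq_of_monic_of_dvd_of_natDegree_le (minpoly.monic hint)
    (monic_X_pow_sub_C g hn.ne') (minpoly.dvd K x (by simp [hx])) ?_).symm
  rw [natDegree_X_pow_sub_C, ← hpb, pb.natDegree_minpoly, hdim]

open Polynomial in
theorem PowerBasis.discr_of_minpoly_eq {K L : Type*} [Field K] [NumberField K] [Field L]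
    [Algebra K L] {n : ℕ} (pb : PowerBasis K L) (hdim : pb.dim = n) {γ : 𝓞 K}
    (hmin : minpoly K pb.gen = X ^ n - C (algebraMap (𝓞 K) K γ)) (hn : 0 < n) :
    ∃ ε : (𝓞 K)ˣ, algebraMap (𝓞 K) K (ε * ((n : 𝓞 K) ^ n * γ ^ (n - 1))) =
      Algebra.discr K pb.basis := by
  have : FiniteDimensional K L := pb.finite
  have hfin : Module.finrank K L = n := by rw [pb.finrank, hdim]
  refine ⟨(-1) ^ (n * (n - 1) / 2) * ((-1) ^ n * -1) ^ (n - 1), ?_⟩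
  have hnorm := Algebra.PowerBasis.norm_gen_eq_coeff_zero_minpoly pb
  rw [hmin, hdim] at hnorm
  rw [Algebra.discr_powerBasis_eq_norm, hmin, hfin]
  have : aeval pb.gen (derivative (X ^ n - C (algebraMap (𝓞 K) K γ))) =
      algebraMap K L n * pb.gen ^ (n - 1) := by simp [derivative_X_pow]
  rw [this, map_mul (Algebra.norm K), map_pow (Algebra.norm K), hnorm, Algebra.norm_algebraMap,
    hfin]
  simp only [Units.val_mul, Units.val_pow_eq_pow_val, Units.val_neg, Units.val_one, map_mul,
    map_pow, map_neg, map_one, map_natCast, coeff_sub, coeff_X_pow, hn.ne, if_false, coeff_C_zero,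
    zero_sub]
  rw [mul_pow _ (-algebraMap (𝓞 K) K γ), neg_pow (algebraMap (𝓞 K) K γ), mul_pow _ (-1 : K)]
  ring

variable {K L : Type*} [Field K] [Field L] [Algebra K L] {n : ℕ}

theorem sum_inv_pow_mul_pow_eq {ζ : K} (hζ : IsPrimitiveRoot ζ n) (i j : Fin n) :
    ∑ k ∈ Finset.range n, (ζ⁻¹ ^ (j : ℕ)) ^ k * (ζ ^ k) ^ (i : ℕ) =
      if i = j then (n : K) else 0 := by
  have hn : n ≠ 0 := by rintro rfl; exact i.elim0
  have h0 : ζ ≠ 0 := hζ.ne_zero hn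
  have : ∀ k ∈ Finset.range n, (ζ⁻¹ ^ (j : ℕ)) ^ k * (ζ ^ k) ^ (i : ℕ) =
      (ζ⁻¹ ^ (j : ℕ) * ζ ^ (i : ℕ)) ^ k := by
    intro k _
    rw [mul_pow, ← pow_mul, ← pow_mul, ← pow_mul, mul_comm k (i : ℕ)]
  rw [Finset.sum_congr rfl this]
  split_ifs with h
  · subst h
    simp [h0]
  · have h1 : ζ⁻¹ ^ (j : ℕ) * ζ ^ (i : ℕ) ≠ 1 := by
      intro h'
      rw [inv_pow, inv_mul_eq_one₀ (pow_ne_zero _ h0)] at h'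
      exact h (Fin.ext (hζ.pow_inj i.2 j.2 h'.symm))
    have h2 := mul_geom_sum (ζ⁻¹ ^ (j : ℕ) * ζ ^ (i : ℕ)) n
    have h3 : (ζ⁻¹ ^ (j : ℕ) * ζ ^ (i : ℕ)) ^ n = 1 := by
      rw [mul_pow, ← pow_mul, ← pow_mul, mul_comm, mul_comm _ n, mul_comm _ n, pow_mul, pow_mul,
        inv_pow, hζ.pow_eq_one]
      simp
    rw [h3, sub_self, mul_eq_zero, sub_eq_zero] at h2
    exact h2.resolve_left h1

/-- The component of an integer along `xʲ` is, up to a factor `n`, again an integer. -/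
theorem isIntegral_natCast_mul_repr_mul_pow {ζ : K} (hζ : IsPrimitiveRoot ζ n) {x : L}
    (hconj : ∀ k : ℕ, ∃ σ : L →ₐ[K] L, σ x = algebraMap K L (ζ ^ k) * x)
    (B : Module.Basis (Fin n) K L) (hB : ∀ j, B j = x ^ (j : ℕ)) {y : L} (hy : IsIntegral ℤ y)
    (j : Fin n) : IsIntegral ℤ (algebraMap K L (n * B.repr y j) * x ^ (j : ℕ)) := by
  have hn : 0 < n := j.pos
  choose σ hσ using hconj
  have hsum : algebraMap K L (n * B.repr y j) * x ^ (j : ℕ) =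
      ∑ k ∈ Finset.range n, algebraMap K L (ζ⁻¹ ^ (j : ℕ)) ^ k * σ k y := by
    have hσy : ∀ k, σ k y = ∑ i, algebraMap K L (B.repr y i * (ζ ^ k) ^ (i : ℕ)) * x ^ (i : ℕ) := by
      intro k
      conv_lhs => rw [← B.sum_repr y]
      rw [map_sum]
      refine Finset.sum_congr rfl fun i _ => ?_
      rw [map_smul, hB, map_pow, hσ, mul_pow, Algebra.smul_def, map_mul, map_pow, map_pow, map_pow,
        mul_assoc]
    simp_rw [hσy, Finset.mul_sum]
    rw [Finset.sum_comm]
    have : ∀ i ∈ Finset.univ, ∑ k ∈ Finset.range n, algebraMap K L (ζ⁻¹ ^ (j : ℕ)) ^ k *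
        (algebraMap K L (B.repr y i * (ζ ^ k) ^ (i : ℕ)) * x ^ (i : ℕ)) =
        algebraMap K L (B.repr y i * if i = j then (n : K) else 0) * x ^ (i : ℕ) := by
      intro i _
      rw [← sum_inv_pow_mul_pow_eq hζ i j, Finset.mul_sum, map_sum, Finset.sum_mul]
      refine Finset.sum_congr rfl fun k _ => ?_
      simp only [map_mul, map_pow]
      ring
    rw [Finset.sum_congr rfl this]
    rw [Finset.sum_eq_single j (by simp +contextual) (by simp), if_pos rfl, mul_comm (n : K)]
  rw [hsum]
  refine IsIntegral.sum _ fun k _ => IsIntegral.mul (IsIntegral.pow ?_ k) (hy.map (σ k))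
  exact ((hζ.inv.isIntegral hn).pow _).map (Algebra.ofId K L)

theorem exists_algebraMap_eq_of_isIntegral {c : K} (h : IsIntegral ℤ (algebraMap K L c)) :
    ∃ a : 𝓞 K, algebraMap (𝓞 K) K a = c :=
  ⟨⟨c, (isIntegral_algebraMap_iff (FaithfulSMul.algebraMap_injective K L)).mp h⟩, rfl⟩

theorem exists_algebraMap_eq_mul_det (B : Module.Basis (Fin n) K L) {M : 𝓞 K}
    (hM : ∀ (y : L), IsIntegral ℤ y → ∀ j, ∃ a : 𝓞 K,
      algebraMap (𝓞 K) K a = algebraMap (𝓞 K) K M * B.repr y j)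
    (b : Fin n → L) (hb : ∀ i, IsIntegral ℤ (b i)) :
    ∃ a : 𝓞 K, algebraMap (𝓞 K) K a = algebraMap (𝓞 K) K (M ^ n) * B.det b := by
  choose a ha using fun i => hM (b i) (hb i)
  refine ⟨(Matrix.of fun i j => a j i).det, ?_⟩
  rw [RingHom.map_det, Module.Basis.det_apply, map_pow]
  have h := Matrix.det_smul (B.toMatrix b) (algebraMap (𝓞 K) K M)
  rw [Fintype.card_fin] at h
  rw [← h]
  congr 1
  ext i j
  simp [ha, Module.Basis.toMatrix_apply]

open IsDedekindDomain WithZero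

theorem WithZero.le_exp_natDiv_of_pow_mul_exp_le_one {z : WithZero (Multiplicative ℤ)}
    {n m j : ℕ} (hn : 0 < n) (h : z ^ n * exp (-(m : ℤ)) ^ j ≤ 1) :
    z ≤ exp ((j * m / n : ℕ) : ℤ) := by
  by_cases hz : z = 0
  · simp [hz]
  rw [← exp_log hz] at h ⊢
  rw [← exp_nsmul, ← exp_nsmul, ← exp_add, ← exp_zero, exp_le_exp] at h
  rw [exp_le_exp]
  push_cast
  rw [Int.le_ediv_iff_mul_le (by positivity)]
  simp only [nsmul_eq_mul] at h
  linarith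

theorem WithZero.prod_exp_natCast {ι : Type*} (s : Finset ι) (f : ι → ℕ) :
    ∏ i ∈ s, exp (f i : ℤ) = exp ((∑ i ∈ s, f i : ℕ) : ℤ) := by
  classical
  induction s using Finset.induction_on with
  | empty => simp
  | insert a s ha ih => rw [Finset.prod_insert ha, Finset.sum_insert ha, ih, ← exp_add]; simp

theorem IsDedekindDomain.HeightOneSpectrum.exists_valuation_eq_exp_one {R K : Type*} [CommRing R]
    [IsDedekindDomain R] [Field K] [Algebra R K] [IsFractionRing R K] (v : HeightOneSpectrum R) :
    ∃ t : K, v.valuation K t = exp (1 : ℤ) ∧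
      ∀ k, ∀ a ∈ v.asIdeal ^ k, ∃ b : R, algebraMap R K b = t ^ k * algebraMap R K a := by
  obtain ⟨π, hπ⟩ := v.intValuation_exists_uniformizer
  have hπ0 : π ≠ 0 := by rintro rfl; rw [map_zero] at hπ; exact exp_ne_zero hπ.symm
  have hπ0' : algebraMap R K π ≠ 0 := by simpa using hπ0
  have hmem : π ∈ v.asIdeal := by
    rw [← v.intValuation_lt_one_iff_mem, hπ, ← exp_zero, exp_lt_exp]
    norm_num
  obtain ⟨C, hC⟩ := Ideal.dvd_span_singleton.mpr hmem
  have hCv : ¬ C ≤ v.asIdeal := by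
    intro h
    have h2 : π ∈ v.asIdeal ^ 2 := by
      rw [pow_two, ← Ideal.span_singleton_le_iff_mem, hC]
      exact Ideal.mul_mono_right h
    rw [← v.intValuation_le_pow_iff_mem, hπ, exp_le_exp] at h2
    norm_num at h2
  obtain ⟨u, huC, huv⟩ := SetLike.not_le_iff_exists.mp hCv
  refine ⟨algebraMap R K u / algebraMap R K π, ?_, fun k a ha => ?_⟩
  · rw [map_div₀, v.valuation_of_algebraMap, v.valuation_of_algebraMap, hπ,
      v.intValuation_eq_one_iff.mpr huv]
    simp
  · have hdvd : π ^ k ∣ u ^ k * a := by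
      rw [← Ideal.mem_span_singleton, ← Ideal.span_singleton_pow, hC, mul_pow, mul_comm]
      exact Ideal.mul_mem_mul (Ideal.pow_mem_pow huC k) ha
    obtain ⟨b, hb⟩ := hdvd
    refine ⟨b, ?_⟩
    have hb' := congrArg (algebraMap R K) hb
    simp only [map_mul, map_pow] at hb'
    rw [div_pow, div_mul_eq_mul_div, hb', mul_div_cancel_left₀ _ (pow_ne_zero k hπ0')]

section Local

variable [NumberField K] (v : HeightOneSpectrum (𝓞 K)) {γ : 𝓞 K} {m : ℕ} {x : L}

theorem valuation_repr_le (hv : (n : 𝓞 K) ∉ v.asIdeal) (hm : v.intValuation γ = exp (-(m : ℤ)))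
    (hx : x ^ n = algebraMap K L (algebraMap (𝓞 K) K γ)) {c : K} {j : ℕ} (hn : 0 < n)
    (hint : IsIntegral ℤ (algebraMap K L (n * c) * x ^ j)) :
    v.valuation K c ≤ exp ((j * m / n : ℕ) : ℤ) := by
  obtain ⟨a, ha⟩ : ∃ a : 𝓞 K, algebraMap (𝓞 K) K a = (n * c) ^ n * algebraMap (𝓞 K) K γ ^ j := by
    apply exists_algebraMap_eq_of_isIntegral (L := L)
    rw [map_mul, map_pow, map_pow, ← hx, ← pow_mul, mul_comm n j, pow_mul, ← mul_pow]
    exact hint.pow n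
  have h1 : v.valuation K (algebraMap (𝓞 K) K a) ≤ 1 := v.valuation_le_one a
  have hvn : v.valuation K (n : K) = 1 := by
    rw [← map_natCast (algebraMap (𝓞 K) K), v.valuation_of_algebraMap,
      v.intValuation_eq_one_iff.mpr hv]
  rw [ha, map_mul, map_pow, map_pow, map_mul, hvn, one_mul, v.valuation_of_algebraMap, hm] at h1
  exact le_exp_natDiv_of_pow_mul_exp_le_one hn h1

theorem valuation_det_le (B : Module.Basis (Fin n) K L) (f : Fin n → ℕ)
    (b : Fin n → L) (hb : ∀ i j, v.valuation K (B.repr (b i) j) ≤ exp (f j : ℤ)) :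
    v.valuation K (B.det b) ≤ exp ((∑ j, f j : ℕ) : ℤ) := by
  rw [Module.Basis.det_apply, Matrix.det_apply]
  refine Valuation.map_sum_le _ fun σ _ => ?_
  have hsign : v.valuation K (Equiv.Perm.sign σ • ∏ i, B.toMatrix b (σ i) i) =
      ∏ i, v.valuation K (B.repr (b i) (σ i)) := by
    rw [Units.smul_def, zsmul_eq_mul, map_mul, map_prod]
    rcases Int.units_eq_one_or (Equiv.Perm.sign σ) with h | h <;>
      simp [h, Module.Basis.toMatrix_apply, Valuation.map_neg]
  rw [hsign]
  calc ∏ i, v.valuation K (B.repr (b i) (σ i)) ≤ ∏ i, exp (f (σ i) : ℤ) :=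
        Finset.prod_le_prod' fun i _ => hb i (σ i)
    _ = ∏ i, exp (f i : ℤ) := Equiv.prod_comp σ fun i => exp (f i : ℤ)
    _ = exp ((∑ j, f j : ℕ) : ℤ) := prod_exp_natCast _ _

theorem exists_isIntegral_valuation_det_eq (hm : v.intValuation γ = exp (-(m : ℤ)))
    (hx : x ^ n = algebraMap K L (algebraMap (𝓞 K) K γ))
    (B : Module.Basis (Fin n) K L) (hB : ∀ j, B j = x ^ (j : ℕ)) :
    ∃ b : Fin n → L, (∀ j, IsIntegral ℤ (b j)) ∧
      v.valuation K (B.det b) = exp ((∑ j : Fin n, j * m / n : ℕ) : ℤ) := by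
  obtain ⟨t, ht, ht'⟩ := v.exists_valuation_eq_exp_one (K := K)
  refine ⟨fun j => t ^ (j * m / n) • B j, fun j => ?_, ?_⟩
  · have hmem : γ ^ (j : ℕ) ∈ v.asIdeal ^ (n * (j * m / n)) := by
      refine Ideal.pow_le_pow_right (Nat.mul_div_le (j * m) n) ?_
      rw [mul_comm, pow_mul]
      exact Ideal.pow_mem_pow ((v.intValuation_le_pow_iff_mem γ m).mp hm.le) _
    obtain ⟨a, ha⟩ := ht' _ _ hmem
    refine IsIntegral.of_pow j.pos ?_
    have : (t ^ (j * m / n) • B j) ^ n = algebraMap K L (algebraMap (𝓞 K) K a) := by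
      rw [ha, hB, smul_pow, ← pow_mul, ← pow_mul, mul_comm (j : ℕ) n, pow_mul x, hx, map_mul,
        Algebra.smul_def, mul_comm n]
      simp
    rw [this]
    exact (RingOfIntegers.isIntegral_coe a).map (Algebra.ofId K L)
  · have := B.det.map_smul_univ (fun j : Fin n => t ^ (j * m / n)) B
    rw [this, B.det_self, smul_eq_mul, mul_one, map_prod, ← prod_exp_natCast]
    refine Finset.prod_congr rfl fun j _ => ?_
    rw [map_pow, ht, ← exp_nsmul, nsmul_eq_mul, mul_one]

theorem emultiplicity_relDisc {ζ : K} (hζ : IsPrimitiveRoot ζ n) (hn : 0 < n)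
    (hconj : ∀ k : ℕ, ∃ σ : L →ₐ[K] L, σ x = algebraMap K L (ζ ^ k) * x)
    (hv : (n : 𝓞 K) ∉ v.asIdeal) (hm : v.intValuation γ = exp (-(m : ℤ)))
    (hx : x ^ n = algebraMap K L (algebraMap (𝓞 K) K γ))
    (B : Module.Basis (Fin n) K L) (hB : ∀ j, B j = x ^ (j : ℕ)) {ε : (𝓞 K)ˣ}
    (hD : algebraMap (𝓞 K) K (ε * ((n : 𝓞 K) ^ n * γ ^ (n - 1))) = Algebra.discr K B) {e : ℕ}
    (he : (n - 1) * m = e + 2 * ∑ j : Fin n, j * m / n) :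
    emultiplicity v.asIdeal (relDisc K L) = e := by
  have hfin : Module.finrank K L = n := by simpa using Module.finrank_eq_card_basis B
  have hvD : v.valuation K (Algebra.discr K B) =
      exp (-((e + 2 * ∑ j : Fin n, j * m / n : ℕ) : ℤ)) := by
    rw [← hD, v.valuation_of_algebraMap, map_mul, map_mul, map_pow, map_pow, hm,
      v.intValuation_eq_one_iff.mpr hv, v.intValuation_eq_one_iff.mpr
        (fun h => v.isPrime.ne_top (Ideal.eq_top_of_isUnit_mem _ h ε.isUnit)), ← he, ← exp_nsmul]
    simp
  rw [emultiplicity_eq_coe, Ideal.dvd_iff_le, Ideal.dvd_iff_le, relDisc_eq_span hfin]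
  constructor
  · rw [Ideal.span_le]
    rintro d ⟨b, hb, hd⟩
    change d ∈ v.asIdeal ^ e
    have hval : v.valuation K (algebraMap (𝓞 K) K d) = v.intValuation d :=
      v.valuation_of_algebraMap d
    have hdet := valuation_det_le v B (fun j => j * m / n) b fun i j =>
      valuation_repr_le v hv hm hx hn
        (isIntegral_natCast_mul_repr_mul_pow hζ hconj B hB (hb i) j)
    rw [← v.intValuation_le_pow_iff_mem, ← hval, hd,
      B.discr_eq_det_sq_mul, map_mul, map_pow, hvD]
    refine (mul_le_mul_left (pow_le_pow_left' hdet 2) _).trans ?_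
    rw [← exp_nsmul, ← exp_add, exp_le_exp]
    push_cast
    simp
  · intro hle
    obtain ⟨b, hb, hdet⟩ := exists_isIntegral_valuation_det_eq v hm hx B hB
    have hdet0 : B.det b ≠ 0 := by
      intro h
      rw [h, map_zero] at hdet
      exact exp_ne_zero hdet.symm
    obtain ⟨hli, hsp⟩ := B.is_basis_iff_det.mpr hdet0.isUnit
    have : FiniteDimensional K L := Module.Finite.of_basis B
    obtain ⟨d, hd⟩ : ∃ d : 𝓞 K, algebraMap (𝓞 K) K d = Algebra.discr K b :=
      ⟨⟨_, Algebra.discr_isIntegral K hb⟩, rfl⟩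
    have hval : v.valuation K (algebraMap (𝓞 K) K d) = v.intValuation d :=
      v.valuation_of_algebraMap d
    have hmem := hle (Ideal.subset_span
      ⟨Module.Basis.mk hli hsp.ge, by simpa using hb, by rw [Module.Basis.coe_mk, hd]⟩)
    rw [← v.intValuation_le_pow_iff_mem, ← hval, hd,
      B.discr_eq_det_sq_mul, map_mul, map_pow, hvD, hdet, ← exp_nsmul, ← exp_add,
      exp_le_exp] at hmem
    push_cast at hmem
    simp at hmem

end Local

end Kummer

theorem Nat.sub_one_mul_eq_two_mul_sum_div {p m : ℕ} (h : p ∣ m) :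
    (p - 1) * m = 2 * ∑ j : Fin p, j * m / p := by
  obtain ⟨k, rfl⟩ := h
  rcases Nat.eq_zero_or_pos p with rfl | hp
  · simp
  have : ∀ j : Fin p, (j : ℕ) * (p * k) / p = j * k := fun j => by
    rw [mul_left_comm, Nat.mul_div_cancel_left _ hp]
  simp_rw [this]
  rw [Fin.sum_univ_eq_sum_range (fun j => j * k), ← Finset.sum_mul, ← mul_assoc, ← mul_assoc,
    mul_comm 2, Finset.sum_range_id_mul_two, mul_comm p]

theorem Nat.Prime.sub_one_mul_eq_add_two_mul_sum_div {p m : ℕ} (hp : p.Prime) (h : ¬ p ∣ m) :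
    (p - 1) * m = (p - 1) + 2 * ∑ j : Fin p, j * m / p := by
  obtain ⟨q, rfl⟩ : ∃ q, p = q + 1 := ⟨p - 1, by have := hp.pos; omega⟩
  rw [Fin.sum_univ_eq_sum_range (fun j => j * m / (q + 1)), Finset.sum_range_succ']
  simp only [zero_mul, Nat.zero_div, add_zero, Nat.add_sub_cancel]
  rw [two_mul]
  nth_rewrite 1 [← Finset.sum_range_reflect]
  rw [← Finset.sum_add_distrib]
  have hm : 0 < m := Nat.pos_of_ne_zero (by rintro rfl; simp at h)
  have : ∀ j ∈ Finset.range q, (q - 1 - j + 1) * m / (q + 1) + (j + 1) * m / (q + 1) = m - 1 := by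
    intro j hj
    rw [Finset.mem_range] at hj
    have hnd : ¬ (q + 1) ∣ (j + 1) * m := by
      rw [hp.dvd_mul, not_or]
      exact ⟨fun hd => by have := Nat.le_of_dvd (by omega) hd; omega, h⟩
    have hsum : (q - 1 - j + 1) * m + (j + 1) * m = (q + 1) * m := by
      rw [← add_mul]; congr 1; omega
    have hr : 0 < (j + 1) * m % (q + 1) := Nat.pos_of_ne_zero fun h0 =>
      hnd (Nat.dvd_of_mod_eq_zero h0)
    generalize (q - 1 - j + 1) * m = a at *
    generalize (j + 1) * m = b at *
    have hq : 0 < q + 1 := q.succ_pos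
    have ha := Nat.div_add_mod a (q + 1)
    have hb := Nat.div_add_mod b (q + 1)
    have ha' := Nat.mod_lt a hq
    have hb' := Nat.mod_lt b hq
    have hlt : a / (q + 1) + b / (q + 1) < m := by
      refine lt_of_mul_lt_mul_left (a := q + 1) ?_ hq.le
      rw [← hsum, mul_add]
      omega
    have hgt : m < a / (q + 1) + b / (q + 1) + 2 := by nlinarith
    omega
  rw [Finset.sum_congr rfl this]
  simp only [Finset.sum_const, Finset.card_range, smul_eq_mul]
  obtain ⟨k, rfl⟩ : ∃ k, m = k + 1 := ⟨m - 1, by omega⟩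
  rw [Nat.add_sub_cancel]
  ring

section Multiplicity

variable {R : Type*} [CommRing R] {ι : Type*} {s : Finset ι} {J : ι → Ideal R}
  {p : Ideal R}

theorem Ideal.emultiplicity_prod_pow_of_not_dvd (hp : Prime p) (h : ∀ i ∈ s, ¬ p ∣ J i)
    (w : ι → ℕ) : emultiplicity p (∏ i ∈ s, J i ^ w i) = 0 := by
  rw [emultiplicity_eq_zero, hp.dvd_finsetProd_iff]
  rintro ⟨i, hi, hd⟩
  exact h i hi (hp.dvd_of_dvd_pow hd)

theorem Ideal.emultiplicity_prod_pow_of_dvd [IsDedekindDomain R] (hp : Prime p)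
    (hsf : ∀ i ∈ s, Squarefree (J i))
    (hcop : ∀ i ∈ s, ∀ j ∈ s, i ≠ j → IsCoprime (J i) (J j)) {i : ι} (hi : i ∈ s) (h : p ∣ J i)
    (w : ι → ℕ) : emultiplicity p (∏ j ∈ s, J j ^ w j) = w i := by
  have hone : emultiplicity p (J i) = 1 := by
    refine le_antisymm ?_ (le_emultiplicity_of_pow_dvd (by simpa using h))
    exact (squarefree_iff_emultiplicity_le_one _).mp (hsf i hi) p |>.resolve_right hp.not_isUnit
  rw [Finset.emultiplicity_prod hp, Finset.sum_eq_single i]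
  · rw [emultiplicity_pow hp, hone, mul_one]
  · intro j hj hji
    rw [emultiplicity_pow hp, emultiplicity_eq_zero.mpr, mul_zero]
    exact fun hd => hp.not_isUnit ((hcop i hi j hj hji.symm).isUnit_of_dvd' h hd)
  · exact fun h => absurd hi h

end Multiplicity

theorem exists_kummerBasis {K L : Type*} [Field K] [NumberField K] [Field L] [Algebra K L] {n : ℕ}
    (hn : 0 < n) {ζ : K} (hζ : IsPrimitiveRoot ζ n) {γ : 𝓞 K} {x : L}
    (hx : x ^ n = algebraMap K L (algebraMap (𝓞 K) K γ))
    (hgen : IntermediateField.adjoin K {x} = ⊤) (hdeg : Module.finrank K L = n) :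
    ∃ B : Module.Basis (Fin n) K L, (∀ j, B j = x ^ (j : ℕ)) ∧
      (∃ ε : (𝓞 K)ˣ, algebraMap (𝓞 K) K (ε * ((n : 𝓞 K) ^ n * γ ^ (n - 1))) = Algebra.discr K B) ∧
      ∀ k : ℕ, ∃ σ : L →ₐ[K] L, σ x = algebraMap K L (ζ ^ k) * x := by
  obtain ⟨pb, rfl, hdim, hmin⟩ := exists_powerBasis_of_pow_eq hn hx hgen hdeg
  refine ⟨pb.basis.reindex (finCongr hdim), fun j => by simp, ?_, fun k => ?_⟩
  · obtain ⟨ε, hε⟩ := pb.discr_of_minpoly_eq hdim hmin hn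
    refine ⟨ε, ?_⟩
    rw [hε, Module.Basis.coe_reindex, Algebra.discr_reindex]
  · refine ⟨pb.lift (algebraMap K L (ζ ^ k) * pb.gen) ?_, pb.lift_gen _ _⟩
    have hk : (ζ ^ k) ^ n = 1 := by rw [← pow_mul, mul_comm, pow_mul, hζ.pow_eq_one, one_pow]
    rw [hmin, map_sub, map_pow, Polynomial.aeval_X, Polynomial.aeval_C, mul_pow, hx, ← map_pow, hk,
      map_one, one_mul, sub_self]

theorem exists_algebraMap_eq_mul_repr {K L : Type*} [Field K] [Field L] [Algebra K L] {n : ℕ}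
    {ζ : K} (hζ : IsPrimitiveRoot ζ n) {γ : 𝓞 K} {x : L}
    (hx : x ^ n = algebraMap K L (algebraMap (𝓞 K) K γ))
    (hconj : ∀ k : ℕ, ∃ σ : L →ₐ[K] L, σ x = algebraMap K L (ζ ^ k) * x)
    (B : Module.Basis (Fin n) K L) (hB : ∀ j, B j = x ^ (j : ℕ)) (hxi : IsIntegral ℤ x) {y : L}
    (hy : IsIntegral ℤ y) (j : Fin n) :
    ∃ a : 𝓞 K, algebraMap (𝓞 K) K a = algebraMap (𝓞 K) K (n * γ) * B.repr y j := by
  apply exists_algebraMap_eq_of_isIntegral (L := L)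
  have h := (isIntegral_natCast_mul_repr_mul_pow hζ hconj B hB hy j).mul (hxi.pow (n - j))
  rw [mul_assoc, ← pow_add, Nat.add_sub_cancel' j.2.le, hx, ← map_mul] at h
  rwa [map_mul (algebraMap (𝓞 K) K), map_natCast, mul_right_comm]

open IsDedekindDomain WithZero in
/-- Away from `ℓ`, the relative discriminant agrees with `(∏ᵢ 𝔍ᵢ)^(ℓ-1)`. -/
theorem emultiplicity_relDisc_eq_prod {ℓ : ℕ} (hℓ : ℓ.Prime) {K L : Type*} [Field K] [NumberField K]
    [Field L] [Algebra K L] {ζ : K} (hζ : IsPrimitiveRoot ζ ℓ) {γ : 𝓞 K} (hγ : γ ≠ 0) {x : L}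
    (hx : x ^ ℓ = algebraMap K L (algebraMap (𝓞 K) K γ))
    (hgen : IntermediateField.adjoin K {x} = ⊤) (hdeg : Module.finrank K L = ℓ)
    {Q 𝔯 : Ideal (𝓞 K)} {J : ℕ → Ideal (𝓞 K)}
    (hfact : Ideal.span {γ} = Q * 𝔯 ^ ℓ * ∏ i ∈ Finset.Ico 1 ℓ, J i ^ i)
    (hJsf : ∀ i ∈ Finset.Ico 1 ℓ, Squarefree (J i))
    (hJcop : ∀ i ∈ Finset.Ico 1 ℓ, ∀ j ∈ Finset.Ico 1 ℓ, i ≠ j → IsCoprime (J i) (J j))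
    {p : Ideal (𝓞 K)} (hp : Prime p) (hpℓ : ¬ p ∣ Ideal.span {(ℓ : 𝓞 K)}) (hpQ : ¬ p ∣ Q) :
    emultiplicity p (relDisc K L) = emultiplicity p ((∏ i ∈ Finset.Ico 1 ℓ, J i) ^ (ℓ - 1)) := by
  obtain ⟨B, hB, ⟨ε, hD⟩, hconj⟩ := exists_kummerBasis hℓ.pos hζ hx hgen hdeg
  let v : HeightOneSpectrum (𝓞 K) := ⟨p, Ideal.isPrime_of_prime hp, hp.ne_zero⟩
  have hγ' : Ideal.span {γ} ≠ 0 := by simpa using hγ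
  have h𝔯 : 𝔯 ≠ 0 := by
    rintro rfl
    simp [hfact, hℓ.ne_zero] at hγ'
  have hv : (ℓ : 𝓞 K) ∉ v.asIdeal := by rwa [Ideal.dvd_span_singleton] at hpℓ
  have hm := v.intValuation_eq_exp_neg_multiplicity hγ
  have hfin : FiniteMultiplicity p 𝔯 := FiniteMultiplicity.of_prime_left hp h𝔯
  have hmul : (multiplicity p (Ideal.span {γ}) : ℕ∞) =
      ℓ * multiplicity p 𝔯 + emultiplicity p (∏ i ∈ Finset.Ico 1 ℓ, J i ^ i) := by
    rw [← (FiniteMultiplicity.of_prime_left hp hγ').emultiplicity_eq_multiplicity, hfact,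
      emultiplicity_mul hp, emultiplicity_mul hp, emultiplicity_eq_zero.mpr hpQ, zero_add,
      emultiplicity_pow hp, hfin.emultiplicity_eq_multiplicity]
  have key := fun e => emultiplicity_relDisc v hζ hℓ.pos hconj hv hm hx B hB hD (e := e)
  have hone : ∏ i ∈ Finset.Ico 1 ℓ, J i = ∏ i ∈ Finset.Ico 1 ℓ, J i ^ 1 := by simp
  rw [emultiplicity_pow hp, hone]
  by_cases h : ∃ i ∈ Finset.Ico 1 ℓ, p ∣ J i
  · obtain ⟨i, hi, hpi⟩ := h
    rw [Ideal.emultiplicity_prod_pow_of_dvd hp hJsf hJcop hi hpi] at hmul ⊢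
    rw [Nat.cast_one, mul_one]
    refine key _ (hℓ.sub_one_mul_eq_add_two_mul_sum_div ?_)
    have hmul' : multiplicity p (Ideal.span {γ}) = ℓ * multiplicity p 𝔯 + i := by
      exact_mod_cast hmul
    change ¬ ℓ ∣ multiplicity p (Ideal.span {γ})
    rw [hmul', ← Nat.dvd_add_iff_right (dvd_mul_right _ _)]
    rw [Finset.mem_Ico] at hi
    exact Nat.not_dvd_of_pos_of_lt hi.1 hi.2
  · push Not at h
    rw [Ideal.emultiplicity_prod_pow_of_not_dvd hp h] at hmul ⊢
    rw [mul_zero]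
    refine key 0 ?_
    have hmul' : multiplicity p (Ideal.span {γ}) = ℓ * multiplicity p 𝔯 := by exact_mod_cast hmul
    rw [zero_add]
    exact Nat.sub_one_mul_eq_two_mul_sum_div ⟨_, hmul'⟩

theorem eq_prod_pow_of_relDisc_eq_mul {ℓ : ℕ} (hℓ : ℓ.Prime) {K L : Type*} [Field K]
    [NumberField K] [Field L] [Algebra K L] {ζ : K} (hζ : IsPrimitiveRoot ζ ℓ) {γ : 𝓞 K}
    (hγ : γ ≠ 0) {x : L} (hx : x ^ ℓ = algebraMap K L (algebraMap (𝓞 K) K γ))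
    (hgen : IntermediateField.adjoin K {x} = ⊤) (hdeg : Module.finrank K L = ℓ)
    {Q 𝔯 : Ideal (𝓞 K)} {J : ℕ → Ideal (𝓞 K)}
    (hfact : Ideal.span {γ} = Q * 𝔯 ^ ℓ * ∏ i ∈ Finset.Ico 1 ℓ, J i ^ i)
    (hQ : ∀ p : Ideal (𝓞 K), p.IsPrime → p ∣ Q → p ∣ Ideal.span {(ℓ : 𝓞 K)})
    (hJsf : ∀ i ∈ Finset.Ico 1 ℓ, Squarefree (J i))
    (hJl : ∀ i ∈ Finset.Ico 1 ℓ, ∀ p : Ideal (𝓞 K), p.IsPrime → p ∣ J i →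
      ¬ p ∣ Ideal.span {(ℓ : 𝓞 K)})
    (hJcop : ∀ i ∈ Finset.Ico 1 ℓ, ∀ j ∈ Finset.Ico 1 ℓ, i ≠ j → IsCoprime (J i) (J j))
    {𝔏 F : Ideal (𝓞 K)} (h𝔏F : relDisc K L = 𝔏 * F) (hF0 : F ≠ 0)
    (h𝔏 : ∀ p : Ideal (𝓞 K), p.IsPrime → p ∣ 𝔏 → p ∣ Ideal.span {(ℓ : 𝓞 K)})
    (hF : ∀ p : Ideal (𝓞 K), p.IsPrime → p ∣ F → ¬ p ∣ Ideal.span {(ℓ : 𝓞 K)}) :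
    F = (∏ i ∈ Finset.Ico 1 ℓ, J i) ^ (ℓ - 1) := by
  have key : ∀ p : Ideal (𝓞 K), Prime p →
      emultiplicity p F = emultiplicity p ((∏ i ∈ Finset.Ico 1 ℓ, J i) ^ (ℓ - 1)) := by
    intro p hp
    have hp' := Ideal.isPrime_of_prime hp
    by_cases hpℓ : p ∣ Ideal.span {(ℓ : 𝓞 K)}
    · rw [emultiplicity_eq_zero.mpr fun h => hF p hp' h hpℓ, eq_comm, emultiplicity_eq_zero]
      intro h
      obtain ⟨i, hi, hd⟩ := (hp.dvd_finsetProd_iff _).mp (hp.dvd_of_dvd_pow h)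
      exact hJl i hi p hp' hd hpℓ
    · rw [← emultiplicity_relDisc_eq_prod hℓ hζ hγ hx hgen hdeg hfact hJsf hJcop hp hpℓ
        fun h => hpℓ (hQ p hp' h), h𝔏F, emultiplicity_mul hp,
        emultiplicity_eq_zero.mpr fun h => hpℓ (h𝔏 p hp' h), zero_add]
  have hJ0 : (∏ i ∈ Finset.Ico 1 ℓ, J i) ^ (ℓ - 1) ≠ 0 :=
    pow_ne_zero _ (Finset.prod_ne_zero_iff.mpr fun i hi => (hJsf i hi).ne_zero)
  apply dvd_antisymm
  · exact (UniqueFactorizationMonoid.dvd_iff_emultiplicity_le hF0).mpr fun p hp => (key p hp).le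
  · exact (UniqueFactorizationMonoid.dvd_iff_emultiplicity_le hJ0).mpr fun p hp => (key p hp).ge

/-- **Steinitz class formula for `ℓ`-Kummer extensions.**
Let `L = K(γ^(1/ℓ))` with `γ𝒪_K = Q·𝔯^ℓ·∏_{i=1}^{ℓ-1} 𝔍ᵢ^i`, where `Q` is the `ℓ`-part,
`𝔯^ℓ` the `ℓ`-power-part, and the `𝔍ᵢ` are pairwise coprime squarefree ideals coprime to
`ℓ𝒪_K`, and let `𝔏` be the `ℓ`-part of the relative discriminant.  Then
`𝔏 / (Q·𝔯^ℓ·∏_{i=2}^{ℓ-1} 𝔍ᵢ^(i-1))^(ℓ-1)` is the square of a fractional ideal `a/b`,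
and the Steinitz class of `L/K` is the class of `a/b` (so its square is the class of the
displayed fractional ideal). -/
theorem steinitz_formula_kummer
    (ℓ : ℕ) (hℓ : ℓ.Prime) (K : Type*) [Field K] [NumberField K]
    (hζ : ∃ ζ : K, IsPrimitiveRoot ζ ℓ)
    (L : Type*) [Field L] [Algebra K L]
    (γ : 𝓞 K) (hγ : γ ≠ 0) (x : L)
    (hx : x ^ ℓ = algebraMap K L (algebraMap (𝓞 K) K γ))
    (hgen : IntermediateField.adjoin K {x} = ⊤)
    (hdeg : Module.finrank K L = ℓ)
    -- the canonical factorization of `γ𝒪_K`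
    (Q 𝔯 : Ideal (𝓞 K)) (J : ℕ → Ideal (𝓞 K))
    (hfact : Ideal.span {γ} = Q * 𝔯 ^ ℓ * ∏ i ∈ Finset.Ico 1 ℓ, J i ^ i)
    (hQ : ∀ p : Ideal (𝓞 K), p.IsPrime → p ∣ Q → p ∣ Ideal.span {(ℓ : 𝓞 K)})
    (h𝔯 : ∀ p : Ideal (𝓞 K), p.IsPrime → p ∣ 𝔯 → ¬ p ∣ Ideal.span {(ℓ : 𝓞 K)})
    (hJsf : ∀ i ∈ Finset.Ico 1 ℓ, Squarefree (J i))
    (hJl : ∀ i ∈ Finset.Ico 1 ℓ, ∀ p : Ideal (𝓞 K), p.IsPrime → p ∣ J i →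
      ¬ p ∣ Ideal.span {(ℓ : 𝓞 K)})
    (hJcop : ∀ i ∈ Finset.Ico 1 ℓ, ∀ j ∈ Finset.Ico 1 ℓ, i ≠ j → IsCoprime (J i) (J j))
    -- `𝔏` is the `ℓ`-part of the relative discriminant, `F` its `ℓ`-free part
    (𝔏 F : Ideal (𝓞 K))
    (h𝔏F : relDisc K L = 𝔏 * F)
    (h𝔏 : ∀ p : Ideal (𝓞 K), p.IsPrime → p ∣ 𝔏 → p ∣ Ideal.span {(ℓ : 𝓞 K)})
    (hF : ∀ p : Ideal (𝓞 K), p.IsPrime → p ∣ F → ¬ p ∣ Ideal.span {(ℓ : 𝓞 K)}) :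
    ∃ a b : (Ideal (𝓞 K))⁰,
      -- `𝔏 / (Q 𝔯^ℓ ∏_{i=2}^{ℓ-1} 𝔍ᵢ^(i-1))^(ℓ-1) = (a/b)²` as fractional ideals
      𝔏 * (b : Ideal (𝓞 K)) ^ 2 =
        (Q * 𝔯 ^ ℓ * ∏ i ∈ Finset.Ico 2 ℓ, J i ^ (i - 1)) ^ (ℓ - 1) *
          (a : Ideal (𝓞 K)) ^ 2 ∧
      -- and the Steinitz class of `L/K` is the class of the square root `a/b`
      ∀ c : ClassGroup (𝓞 K), IsSteinitzClass K L c →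
        c = ClassGroup.mk0 a * (ClassGroup.mk0 b)⁻¹ := by
  obtain ⟨ζ, hζ⟩ := hζ
  have : NeZero ℓ := ⟨hℓ.ne_zero⟩
  obtain ⟨B, hB, ⟨ε, hD⟩, hconj⟩ := exists_kummerBasis hℓ.pos hζ hx hgen hdeg
  have hxi : IsIntegral ℤ x := by
    refine IsIntegral.of_pow hℓ.pos ?_
    rw [hx]
    exact (RingOfIntegers.isIntegral_coe γ).map (Algebra.ofId K L)
  have hden := exists_algebraMap_eq_mul_det B (M := ℓ * γ) fun y hy j =>
    exists_algebraMap_eq_mul_repr hζ hx hconj B hB hxi hy j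
  have hN : ((ℓ : 𝓞 K) * γ) ^ ℓ ≠ 0 :=
    pow_ne_zero _ (mul_ne_zero (Nat.cast_ne_zero.mpr hℓ.ne_zero) hγ)
  have hmemA : ((ℓ : 𝓞 K) * γ) ^ ℓ ∈ detIdeal B (((ℓ : 𝓞 K) * γ) ^ ℓ) :=
    Ideal.subset_span ⟨B, fun j => by rw [hB]; exact hxi.pow _, by rw [B.det_self, mul_one]⟩
  have hmain := span_sq_mul_relDisc B hden hD
  obtain ⟨s, hs⟩ := hζ.toInteger_isPrimitiveRoot.exists_sq_associated_natCast_pow hℓ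
  generalize ((ℓ : 𝓞 K) * γ) ^ ℓ = N at *
  have hA : detIdeal B N ≠ 0 := fun h => hN (by simpa [h] using hmemA)
  have hs0 : s ≠ 0 := by
    rintro rfl
    simp [hℓ.ne_zero] at hs
  have hspan : ∀ {a : 𝓞 K}, a ≠ 0 → Ideal.span {a} ≠ 0 := fun ha => by simpa using ha
  have hDs : Ideal.span {(ε : 𝓞 K) * ((ℓ : 𝓞 K) ^ ℓ * γ ^ (ℓ - 1))} =
      Ideal.span {s} ^ 2 * Ideal.span {γ} ^ (ℓ - 1) := by
    rw [Ideal.span_singleton_mul_left_unit ε.isUnit, ← Ideal.span_singleton_mul_span_singleton,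
      Ideal.span_singleton_eq_span_singleton.mpr hs, Ideal.span_singleton_pow,
      Ideal.span_singleton_pow]
  have hF0 : F ≠ 0 := by
    rintro rfl
    rw [h𝔏F, hDs, mul_zero, mul_zero] at hmain
    exact mul_ne_zero (mul_ne_zero (pow_ne_zero _ (hspan hs0)) (pow_ne_zero _ (hspan hγ)))
      (pow_ne_zero 2 hA) hmain.symm
  have hFeq := eq_prod_pow_of_relDisc_eq_mul hℓ hζ hγ hx hgen hdeg hfact hQ hJsf hJl hJcop h𝔏F hF0
    h𝔏 hF
  have hfact' : Ideal.span {γ} = (Q * 𝔯 ^ ℓ * ∏ i ∈ Finset.Ico 2 ℓ, J i ^ (i - 1)) *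
      ∏ i ∈ Finset.Ico 1 ℓ, J i := by
    have hshift : ∏ i ∈ Finset.Ico 2 ℓ, J i ^ (i - 1) = ∏ i ∈ Finset.Ico 1 ℓ, J i ^ (i - 1) := by
      rw [Finset.prod_eq_prod_Ico_succ_bot hℓ.one_lt]
      simp
    rw [hfact, hshift, mul_assoc (Q * 𝔯 ^ ℓ), ← Finset.prod_mul_distrib]
    congr 1
    refine Finset.prod_congr rfl fun i hi => ?_
    rw [← pow_succ, Nat.sub_add_cancel (Finset.mem_Ico.mp hi).1]
  refine ⟨⟨Ideal.span {s} * detIdeal B N, mem_nonZeroDivisors_of_ne_zero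
    (mul_ne_zero (hspan hs0) hA)⟩, ⟨Ideal.span {N}, mem_nonZeroDivisors_of_ne_zero (hspan hN)⟩,
    ?_, fun c hc => ?_⟩
  · apply mul_right_cancel₀ hF0
    rw [h𝔏F, hDs, hfact', mul_pow _ (∏ i ∈ Finset.Ico 1 ℓ, J i), ← hFeq] at hmain
    calc 𝔏 * Ideal.span {N} ^ 2 * F = Ideal.span {N} ^ 2 * (𝔏 * F) := by ring
      _ = _ := by rw [hmain]; ring
  · rw [hc.eq_mk0_of_eq_detIdeal hℓ.pos B hN hden ⟨_, mem_nonZeroDivisors_of_ne_zero hA⟩ rfl,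
      (ClassGroup.mk0_eq_one_iff (I := Ideal.span {N}) _).mpr ⟨N, rfl⟩, inv_one, mul_one]
    exact ClassGroup.mk0_eq_mk0_iff.mpr ⟨s, 1, hs0, one_ne_zero, by simp⟩

end
end

section
/- Let K be a number field, γ ∈ 𝒪_K nonzero, and L = K(√γ) a quadratic extension of K. Let 𝔯² be the largest odd square ideal dividing γ𝒪_K (the 2-power-part of the odd part of γ𝒪_K), let Q be the even part of γ𝒪_K (the product of the prime powers in γ𝒪_K at primes dividing 2𝒪_K), and let 𝔏_{L/K} be the even part of the relative discriminant Δ_{L/K}. Then the fractional ideal 𝔏_{L/K}/(Q𝔯²) is the square of a fractional ideal, the square of the Steinitz class St(𝒪_L) equals the class of 𝔏_{L/K}/(Q𝔯²) in Cl(K), and St(𝒪_L) is the class of its unique square root. -/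
open NumberField Filter
open scoped nonZeroDivisors

noncomputable section

section Coordinates

variable {K L : Type*} [Field K] [Field L] [Algebra K L] (b : Module.Basis (Fin 2) K L)

theorem eq_algebraMap_add_of_basis (h0 : b 0 = 1) (z : L) :
    z = algebraMap K L (b.repr z 0) + algebraMap K L (b.repr z 1) * b 1 := by
  conv_lhs => rw [← b.sum_repr z]
  simp [Fin.sum_univ_two, h0, Algebra.smul_def]

theorem repr_algebraMap_add (h0 : b 0 = 1) (r s : K) :
    b.repr (algebraMap K L r + algebraMap K L s * b 1) 0 = r ∧
      b.repr (algebraMap K L r + algebraMap K L s * b 1) 1 = s := by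
  have : algebraMap K L r + algebraMap K L s * b 1 = r • b 0 + s • b 1 := by
    simp [h0, Algebra.smul_def]
  rw [this]
  simp

variable {c : K}

theorem repr_mul_of_sq (h0 : b 0 = 1) (h1 : b 1 ^ 2 = algebraMap K L c) (u v : L) :
    b.repr (u * v) 0 = b.repr u 0 * b.repr v 0 + c * b.repr u 1 * b.repr v 1 ∧
      b.repr (u * v) 1 = b.repr u 0 * b.repr v 1 + b.repr u 1 * b.repr v 0 := by
  have : u * v = algebraMap K L (b.repr u 0 * b.repr v 0 + c * b.repr u 1 * b.repr v 1) +
      algebraMap K L (b.repr u 0 * b.repr v 1 + b.repr u 1 * b.repr v 0) * b 1 := by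
    conv_lhs => rw [eq_algebraMap_add_of_basis b h0 u, eq_algebraMap_add_of_basis b h0 v]
    simp only [map_add, map_mul, ← h1]
    ring
  rw [this]
  exact repr_algebraMap_add b h0 _ _

theorem trace_eq_two_mul_repr (h0 : b 0 = 1) (h1 : b 1 ^ 2 = algebraMap K L c) (z : L) :
    Algebra.trace K L z = 2 * b.repr z 0 := by
  rw [Algebra.trace_eq_matrix_trace b, Matrix.trace_fin_two, Algebra.leftMulMatrix_eq_repr_mul,
    Algebra.leftMulMatrix_eq_repr_mul, (repr_mul_of_sq b h0 h1 _ _).2, h0, mul_one]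
  simp
  ring

theorem discr_eq_sq_mul (h0 : b 0 = 1) (h1 : b 1 ^ 2 = algebraMap K L c) (v : Fin 2 → L) :
    Algebra.discr K v =
      (b.repr (v 0) 0 * b.repr (v 1) 1 - b.repr (v 0) 1 * b.repr (v 1) 0) ^ 2 * (4 * c) := by
  rw [Algebra.discr_def, Matrix.det_fin_two]
  simp only [Algebra.traceMatrix_apply, Algebra.traceForm_apply, trace_eq_two_mul_repr b h0 h1,
    (repr_mul_of_sq b h0 h1 _ _).1]
  ring

theorem isIntegral_conj (h0 : b 0 = 1)
    (h1 : b 1 ^ 2 = algebraMap K L c)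
    {z : L} (hz : IsIntegral ℤ z) :
    IsIntegral ℤ (algebraMap K L (b.repr z 0) - algebraMap K L (b.repr z 1) * b 1) := by
  have : FiniteDimensional K L := b.finiteDimensional_of_finite
  have ht : IsIntegral ℤ (Algebra.trace K L z) := Algebra.isIntegral_trace hz
  have e : algebraMap K L (b.repr z 0) - algebraMap K L (b.repr z 1) * b 1 =
      algebraMap K L (Algebra.trace K L z) - z := by
    rw [trace_eq_two_mul_repr b h0 h1, map_mul, map_ofNat]
    linear_combination eq_algebraMap_add_of_basis b h0 z
  rw [e]
  exact ht.algebraMap.sub hz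

end Coordinates

section Integral

variable {K L : Type*} [Field K] [NumberField K] [Field L] [Algebra K L]
  (b : Module.Basis (Fin 2) K L)

/-- The ideal of those `n : 𝓞 K` that are second coordinates, with respect to `b`, of integral
elements of `L`. -/
def coordIdeal : Ideal (𝓞 K) where
  carrier := {n | ∃ z : L, IsIntegral ℤ z ∧ b.repr z 1 = algebraMap (𝓞 K) K n}
  zero_mem' := ⟨0, isIntegral_zero, by simp⟩
  add_mem' := by
    rintro m n ⟨z, hz, hz'⟩ ⟨w, hw, hw'⟩
    exact ⟨z + w, hz.add hw, by simp [hz', hw']⟩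
  smul_mem' := by
    rintro r n ⟨z, hz, hz'⟩
    refine ⟨algebraMap K L r * z, (r.isIntegral_coe.algebraMap).mul hz, ?_⟩
    rw [← Algebra.smul_def, map_smul, Finsupp.smul_apply, hz', smul_eq_mul, smul_eq_mul, map_mul]

variable {γ : 𝓞 K}

theorem exists_repr_one_eq (h0 : b 0 = 1)
    (h1 : b 1 ^ 2 = algebraMap K L (4 * algebraMap (𝓞 K) K γ)⁻¹)
    (hγ : γ ≠ 0) {z : L} (hz : IsIntegral ℤ z) :
    ∃ n ∈ coordIdeal b, b.repr z 1 = algebraMap (𝓞 K) K n := by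
  have hγ' : algebraMap (𝓞 K) K γ ≠ 0 := by simpa using hγ
  have hi : IsIntegral ℤ ((b.repr z 1) ^ 2 * (algebraMap (𝓞 K) K γ)⁻¹) := by
    have e : algebraMap K L ((b.repr z 1) ^ 2 * (algebraMap (𝓞 K) K γ)⁻¹) =
        (z - (algebraMap K L (b.repr z 0) - algebraMap K L (b.repr z 1) * b 1)) ^ 2 := by
      have hz' : z - (algebraMap K L (b.repr z 0) - algebraMap K L (b.repr z 1) * b 1) =
          algebraMap K L (2 * b.repr z 1) * b 1 := by
        rw [map_mul, map_ofNat]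
        linear_combination eq_algebraMap_add_of_basis b h0 z
      rw [hz', mul_pow, h1, ← map_pow (algebraMap K L), ← map_mul]
      congr 1
      field_simp
      norm_num
    rw [← isIntegral_algebraMap_iff (algebraMap K L).injective, e]
    exact (hz.sub (isIntegral_conj b h0 h1 hz)).pow 2
  have hr : IsIntegral ℤ (b.repr z 1) := by
    rw [← IsIntegral.pow_iff two_pos]
    have := hi.mul γ.isIntegral_coe
    rwa [inv_mul_cancel_right₀ hγ'] at this
  exact ⟨⟨_, hr⟩, ⟨z, hz, rfl⟩, rfl⟩

theorem exists_wedge_eq (h0 : b 0 = 1)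
    (h1 : b 1 ^ 2 = algebraMap K L (4 * algebraMap (𝓞 K) K γ)⁻¹)
    (hγ : γ ≠ 0) {u v : L} (hu : IsIntegral ℤ u) (hv : IsIntegral ℤ v) :
    ∃ n ∈ coordIdeal b, b.repr u 0 * b.repr v 1 - b.repr u 1 * b.repr v 0 =
      algebraMap (𝓞 K) K n := by
  obtain ⟨n, hn, h⟩ :=
    exists_repr_one_eq b h0 h1 hγ ((isIntegral_conj b h0 h1 hu).mul hv)
  refine ⟨n, hn, ?_⟩
  rw [← h, (repr_mul_of_sq b h0 h1 _ _).2, sub_eq_add_neg (algebraMap K L _), ← neg_mul,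
    ← map_neg (algebraMap K L), (repr_algebraMap_add b h0 _ _).1, (repr_algebraMap_add b h0 _ _).2]
  ring

theorem two_mul_mem_coordIdeal (h0 : b 0 = 1)
    (h1 : b 1 ^ 2 = algebraMap K L (4 * algebraMap (𝓞 K) K γ)⁻¹)
    (hγ : γ ≠ 0) {n : 𝓞 K} (hn : γ ∣ n ^ 2) :
    2 * n ∈ coordIdeal b := by
  obtain ⟨m, hm⟩ := hn
  refine ⟨algebraMap K L 0 + algebraMap K L (algebraMap (𝓞 K) K (2 * n)) * b 1, ?_,
    (repr_algebraMap_add b h0 _ _).2⟩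
  have hγ' : algebraMap (𝓞 K) K γ ≠ 0 := by simpa using hγ
  have e : (algebraMap K L 0 + algebraMap K L (algebraMap (𝓞 K) K (2 * n)) * b 1) ^ 2 =
      algebraMap K L (algebraMap (𝓞 K) K m) := by
    rw [map_zero, zero_add, mul_pow, h1, ← map_pow, ← map_pow, ← map_mul, mul_pow, hm]
    congr 1
    simp only [map_mul, map_pow, map_ofNat]
    field_simp
    ring
  rw [← IsIntegral.pow_iff two_pos, e]
  exact m.isIntegral_coe.algebraMap

end Integral

section Steinitz

variable {K L : Type*} [Field K] [NumberField K] [Field L] [Algebra K L]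
  (b : Module.Basis (Fin 2) K L) {γ : 𝓞 K}

theorem coordIdeal_ne_bot (h0 : b 0 = 1)
    (h1 : b 1 ^ 2 = algebraMap K L (4 * algebraMap (𝓞 K) K γ)⁻¹) (hγ : γ ≠ 0) :
    coordIdeal b ≠ ⊥ := by
  intro h
  have := two_mul_mem_coordIdeal b h0 h1 hγ (n := γ) ⟨γ, sq γ⟩
  rw [h, Ideal.mem_bot] at this
  simp [hγ] at this

/-- A linear isomorphism `𝓞 L ≃ 𝓞 K ⊕ I` forces `I` to lie in the class of the ideal of second
coordinates. -/
theorem mk0_eq_mk0_coordIdeal (h0 : b 0 = 1)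
    (h1 : b 1 ^ 2 = algebraMap K L (4 * algebraMap (𝓞 K) K γ)⁻¹) (hγ : γ ≠ 0)
    (I B : (Ideal (𝓞 K))⁰) (hB : (B : Ideal (𝓞 K)) = coordIdeal b)
    (e : 𝓞 L ≃ₗ[𝓞 K] (Fin 1 → 𝓞 K) × (I : Ideal (𝓞 K))) :
    ClassGroup.mk0 I = ClassGroup.mk0 B := by
  obtain ⟨i₀, hi₀, hi₀'⟩ := Submodule.exists_mem_ne_zero_of_ne_bot (nonZeroDivisors.coe_ne_zero I)
  set u : L := algebraMap (𝓞 L) L (e.symm (1, 0)) with hu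
  set v : L := algebraMap (𝓞 L) L (e.symm (0, ⟨i₀, hi₀⟩)) with hv
  have hui : IsIntegral ℤ u := RingOfIntegers.isIntegral_coe _
  have hvi : IsIntegral ℤ v := RingOfIntegers.isIntegral_coe _
  have smul_coe (r : 𝓞 K) (z : 𝓞 L) :
      algebraMap (𝓞 L) L (r • z) = algebraMap (𝓞 K) K r • algebraMap (𝓞 L) L z := by
    rw [Algebra.smul_def, Algebra.smul_def, map_mul, ← IsScalarTower.algebraMap_apply,
      ← IsScalarTower.algebraMap_apply]
  have key (s : 𝓞 K) (i : (I : Ideal (𝓞 K))) :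
      algebraMap (𝓞 K) K i₀ • algebraMap (𝓞 L) L (e.symm (fun _ ↦ s, i)) =
        algebraMap (𝓞 K) K (i₀ * s) • u + algebraMap (𝓞 K) K i • v := by
    rw [hu, hv, ← smul_coe, ← smul_coe, ← smul_coe, ← map_add, ← map_smul, ← map_smul,
      ← map_smul, ← map_add]
    congr 2
    ext j
    · simp
    · simp [mul_comm]
  obtain ⟨w, hw, hw'⟩ := exists_wedge_eq b h0 h1 hγ hui hvi
  have hi₀K : algebraMap (𝓞 K) K i₀ ≠ 0 := by simpa using hi₀'
  have hle : Ideal.span {w} * (I : Ideal (𝓞 K)) = Ideal.span {i₀} * coordIdeal b := by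
    apply le_antisymm
    · rw [Ideal.span_singleton_mul_le_iff]
      intro i hi
      obtain ⟨n, hn, hn'⟩ := exists_wedge_eq b h0 h1 hγ hui
        (RingOfIntegers.isIntegral_coe (e.symm (fun _ ↦ 0, ⟨i, hi⟩)))
      refine Ideal.mem_span_singleton_mul.2 ⟨n, hn, ?_⟩
      have hk := congrArg b.repr (key 0 ⟨i, hi⟩)
      have hk0 := DFunLike.congr_fun hk 0
      have hk1 := DFunLike.congr_fun hk 1
      simp only [map_smul, map_zero, mul_zero, zero_smul, zero_add,
        Finsupp.smul_apply, smul_eq_mul] at hk0 hk1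
      apply RingOfIntegers.coe_injective
      rw [map_mul, map_mul]
      linear_combination (-algebraMap (𝓞 K) K i₀) * hn' + b.repr u 0 * hk1 -
        b.repr u 1 * hk0 + algebraMap (𝓞 K) K i * hw'
    · rw [Ideal.span_singleton_mul_le_iff]
      rintro n ⟨z, hz, hzn⟩
      obtain ⟨⟨s, i⟩, hsi⟩ := e.symm.surjective 1
      obtain ⟨z, rfl⟩ : ∃ y : 𝓞 L, algebraMap (𝓞 L) L y = z := ⟨⟨z, hz⟩, rfl⟩
      obtain ⟨⟨s', i'⟩, hsi'⟩ := e.symm.surjective z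
      have hs : s = fun _ ↦ s 0 := by ext j; rw [Subsingleton.elim j 0]
      have hs' : s' = fun _ ↦ s' 0 := by ext j; rw [Subsingleton.elim j 0]
      have hk := congrArg b.repr (key (s 0) i)
      have hk' := congrArg b.repr (key (s' 0) i')
      rw [← hs, hsi, map_one, ← h0] at hk
      rw [← hs', hsi'] at hk'
      have hk0 := DFunLike.congr_fun hk 0
      have hk1 := DFunLike.congr_fun hk 1
      have hk0' := DFunLike.congr_fun hk' 0
      have hk1' := DFunLike.congr_fun hk' 1
      simp only [map_smul, map_add, map_mul, Finsupp.smul_apply, Finsupp.add_apply, smul_eq_mul,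
        b.repr_self, Finsupp.single_eq_same, mul_one] at hk0 hk1 hk0' hk1'
      rw [Finsupp.single_eq_of_ne (by decide), mul_zero] at hk1
      rw [hzn] at hk1'
      refine Ideal.mem_span_singleton_mul.2 ⟨s 0 * i' - s' 0 * i,
        sub_mem (Ideal.mul_mem_left _ _ i'.2) (Ideal.mul_mem_left _ _ i.2), ?_⟩
      apply RingOfIntegers.coe_injective
      simp only [map_mul, map_sub]
      rw [← hw']
      apply mul_left_cancel₀ hi₀K
      linear_combination -hk0 * (algebraMap (𝓞 K) K i₀ * algebraMap (𝓞 K) K (s' 0) * b.repr u 1 +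
          algebraMap (𝓞 K) K i' * b.repr v 1) - algebraMap (𝓞 K) K i₀ * hk1' +
        hk1 * (algebraMap (𝓞 K) K i₀ * algebraMap (𝓞 K) K (s' 0) * b.repr u 0 +
          algebraMap (𝓞 K) K i' * b.repr v 0)
  have hw0 : w ≠ 0 := by
    rintro rfl
    rw [Ideal.span_singleton_zero, Ideal.bot_mul, eq_comm, Ideal.mul_eq_bot] at hle
    rcases hle with h | h
    · simp [hi₀'] at h
    · exact coordIdeal_ne_bot b h0 h1 hγ h
  rw [ClassGroup.mk0_eq_mk0_iff]
  exact ⟨w, i₀, hw0, by simpa, by rw [hB]; exact hle⟩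

end Steinitz

section Ideals

variable {R : Type*} [CommRing R] [IsDedekindDomain R]

theorem Ideal.mul_mem_span_sq_pair (m n : R) : m * n ∈ Ideal.span {m ^ 2, n ^ 2} := by
  by_cases hA : Ideal.span {m, n} = ⊥
  · rw [Ideal.span_eq_bot] at hA
    simp [hA m (by simp)]
  have h : Ideal.span {m, n} * (Ideal.span {m, n} * Ideal.span {m, n}) =
      Ideal.span {m, n} * Ideal.span {m ^ 2, n ^ 2} := by
    refine le_antisymm ?_ (Ideal.mul_mono_right ?_)
    · rw [Ideal.span_pair_mul_span_pair m n (m ^ 2), Ideal.span_pair_mul_span_pair m n m n,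
        Ideal.span_mul_span', Ideal.span_le]
      rintro _ ⟨y, hy, z, hz, rfl⟩
      simp only [Set.mem_insert_iff, Set.mem_singleton_iff] at hy hz
      refine Ideal.subset_span ?_
      simp only [Set.mem_insert_iff, Set.mem_singleton_iff]
      rcases hy with rfl | rfl <;> rcases hz with rfl | rfl | rfl | rfl <;> grind
    · rw [Ideal.span_le, Set.insert_subset_iff, Set.singleton_subset_iff, sq, sq]
      exact ⟨Ideal.mul_mem_mul (Ideal.subset_span (by simp)) (Ideal.subset_span (by simp)),
        Ideal.mul_mem_mul (Ideal.subset_span (by simp)) (Ideal.subset_span (by simp))⟩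
  rw [← mul_left_cancel₀ hA h]
  exact Ideal.mul_mem_mul (Ideal.subset_span (by simp)) (Ideal.subset_span (by simp))

theorem dvd_of_squarefree_of_mul_eq_sq {S T E N B : Ideal R} (hS : Squarefree S)
    (h : E * N ^ 2 * (S * T) = B ^ 2) (hB : B ≠ ⊥)
    (hE : ∀ p : Ideal R, Prime p → p ∣ S → ¬ p ∣ E) : S ∣ T := by
  classical
  have hne : E * N ^ 2 * (S * T) ≠ 0 := by rw [h]; exact pow_ne_zero _ hB
  simp only [ne_eq, mul_eq_zero, not_or] at hne
  obtain ⟨⟨hE0, hN0⟩, hS0, hT0⟩ := hne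
  rw [UniqueFactorizationMonoid.dvd_iff_normalizedFactors_le_normalizedFactors hS0 hT0,
    Multiset.le_iff_subset
      ((UniqueFactorizationMonoid.squarefree_iff_nodup_normalizedFactors hS0).1 hS)]
  intro p hp
  obtain ⟨hpp, hpS⟩ := (UniqueFactorizationMonoid.mem_normalizedFactors_iff hS0).1 hp
  by_contra hpT
  have hcE : (UniqueFactorizationMonoid.normalizedFactors E).count p = 0 := by
    rw [Multiset.count_eq_zero]
    exact fun h ↦ hE p hpp hpS (UniqueFactorizationMonoid.dvd_of_mem_normalizedFactors h)
  have hcS : (UniqueFactorizationMonoid.normalizedFactors S).count p = 1 :=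
    Multiset.count_eq_one_of_mem
      ((UniqueFactorizationMonoid.squarefree_iff_nodup_normalizedFactors hS0).1 hS) hp
  have hc := congrArg (fun J ↦ (UniqueFactorizationMonoid.normalizedFactors J).count p) h
  simp only [UniqueFactorizationMonoid.normalizedFactors_pow] at hc
  rw [UniqueFactorizationMonoid.normalizedFactors_mul (mul_ne_zero hE0 hN0) (mul_ne_zero hS0 hT0),
    UniqueFactorizationMonoid.normalizedFactors_mul hE0 hN0,
    UniqueFactorizationMonoid.normalizedFactors_mul hS0 hT0,
    UniqueFactorizationMonoid.normalizedFactors_pow] at hc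
  simp only [Multiset.count_add, Multiset.count_nsmul, hcE, hcS, Multiset.count_eq_zero.2 hpT] at hc
  omega

end Ideals

section RelDisc

variable {K L : Type*} [Field K] [NumberField K] [Field L] [Algebra K L]
  (b : Module.Basis (Fin 2) K L) {γ : 𝓞 K}

theorem relDisc_eq_span_of_finrank_eq_two (hdeg : Module.finrank K L = 2) :
    relDisc K L = Ideal.span {d : 𝓞 K | ∃ v : Module.Basis (Fin 2) K L,
      (∀ i, IsIntegral ℤ (v i)) ∧ algebraMap (𝓞 K) K d = Algebra.discr K ⇑v} := by
  rw [relDisc, hdeg]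

/-- The relative discriminant of `K(√γ)/K` in terms of the ideal of second coordinates. -/
theorem span_mul_relDisc_eq_sq (h0 : b 0 = 1)
    (h1 : b 1 ^ 2 = algebraMap K L (4 * algebraMap (𝓞 K) K γ)⁻¹) (hγ : γ ≠ 0) :
    Ideal.span {γ} * relDisc K L = coordIdeal b ^ 2 := by
  have : FiniteDimensional K L := b.finiteDimensional_of_finite
  have hγ' : algebraMap (𝓞 K) K γ ≠ 0 := by simpa using hγ
  have hdeg : Module.finrank K L = 2 := by simpa using Module.finrank_eq_card_basis b
  rw [relDisc_eq_span_of_finrank_eq_two hdeg]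
  apply le_antisymm
  · rw [Ideal.span_mul_span', Ideal.span_le]
    rintro _ ⟨g, hg, d, ⟨v, hv, hd⟩, rfl⟩
    obtain ⟨n, hn, hn'⟩ := exists_wedge_eq b h0 h1 hγ (hv 0) (hv 1)
    have : γ * d = n ^ 2 := by
      apply RingOfIntegers.coe_injective
      rw [map_mul, hd, discr_eq_sq_mul b h0 h1, hn', map_pow]
      field_simp
    change g * d ∈ _
    rw [Set.mem_singleton_iff.1 hg, this]
    exact Ideal.pow_mem_pow hn 2
  · have hsq (n : 𝓞 K) (hn : n ∈ coordIdeal b) :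
        n ^ 2 ∈ Ideal.span {γ} * Ideal.span {d : 𝓞 K | ∃ v : Module.Basis (Fin 2) K L,
          (∀ i, IsIntegral ℤ (v i)) ∧ algebraMap (𝓞 K) K d = Algebra.discr K ⇑v} := by
      rcases eq_or_ne n 0 with rfl | hn0
      · simp
      obtain ⟨z, hz, hzn⟩ := hn
      have hli : LinearIndependent K ![(1 : L), z] := by
        rw [LinearIndependent.pair_iff]
        intro s t hst
        have hst1 := DFunLike.congr_fun (congrArg b.repr hst) 1
        have hst0 := DFunLike.congr_fun (congrArg b.repr hst) 0
        rw [← h0] at hst0 hst1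
        have ht : t = 0 := by simpa [hzn, hn0] using hst1
        exact ⟨by simpa [ht] using hst0, ht⟩
      let v := basisOfLinearIndependentOfCardEqFinrank hli (by simp [hdeg])
      have hv : ⇑v = ![(1 : L), z] := coe_basisOfLinearIndependentOfCardEqFinrank hli _
      have hvi : ∀ i, IsIntegral ℤ (v i) := by
        rw [hv, Fin.forall_fin_two]
        exact ⟨isIntegral_one, hz⟩
      have hdi : IsIntegral ℤ (Algebra.discr K ⇑v) := Algebra.discr_isIntegral K hvi
      obtain ⟨d, hd⟩ : ∃ d : 𝓞 K, algebraMap (𝓞 K) K d = Algebra.discr K ⇑v := ⟨⟨_, hdi⟩, rfl⟩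
      refine Ideal.mem_span_singleton_mul.2 ⟨d, Ideal.subset_span ⟨v, hvi, hd⟩, ?_⟩
      apply RingOfIntegers.coe_injective
      rw [map_mul, hd, discr_eq_sq_mul b h0 h1, hv]
      simp only [Matrix.cons_val_zero, Matrix.cons_val_one, ← h0, hzn]
      simp
      field_simp
    rw [sq, Ideal.mul_le]
    intro m hm n hn
    refine (Ideal.span_le.2 ?_ : Ideal.span {m ^ 2, n ^ 2} ≤ _) (Ideal.mul_mem_span_sq_pair m n)
    rintro _ (rfl | rfl)
    exacts [hsq m hm, hsq n hn]

/-- The odd part of the relative discriminant of `K(√γ)/K` is squarefree. -/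
theorem dvd_span_two_of_sq_dvd_relDisc (h0 : b 0 = 1)
    (h1 : b 1 ^ 2 = algebraMap K L (4 * algebraMap (𝓞 K) K γ)⁻¹) (hγ : γ ≠ 0)
    {p : Ideal (𝓞 K)} (hp : p ^ 2 ∣ relDisc K L) : p ∣ Ideal.span {(2 : 𝓞 K)} := by
  have hB := coordIdeal_ne_bot b h0 h1 hγ
  have h := span_mul_relDisc_eq_sq b h0 h1 hγ
  obtain ⟨D, hD⟩ := hp
  obtain ⟨C, hC⟩ : p ∣ coordIdeal b := by
    rw [← UniqueFactorizationMonoid.pow_dvd_pow_iff_dvd two_ne_zero, ← h, hD]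
    exact ⟨Ideal.span {γ} * D, by ring⟩
  have hp0 : p ≠ 0 := by rintro rfl; exact hB (by simpa using hC)
  have hC0 : C ≠ 0 := by rintro rfl; exact hB (by simpa using hC)
  have hCD : C ^ 2 = Ideal.span {γ} * D := by
    apply mul_left_cancel₀ (pow_ne_zero 2 hp0)
    rw [← mul_pow, ← hC, ← h, hD]
    ring
  have hle : Ideal.span {(2 : 𝓞 K)} * C ≤ p * C := by
    rw [← hC, Ideal.span_singleton_mul_le_iff]
    intro n hn
    apply two_mul_mem_coordIdeal b h0 h1 hγ
    have hn2 := Ideal.pow_mem_pow hn 2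
    rw [hCD, Ideal.mem_span_singleton_mul] at hn2
    obtain ⟨m, -, hm⟩ := hn2
    exact ⟨m, hm.symm⟩
  rw [← mul_dvd_mul_iff_right hC0]
  exact Ideal.dvd_iff_le.2 hle

/-- A quadratic extension `K(x)/K` with `x ^ 2 = γ` has the `K`-basis `1, x / (2γ)`. -/
theorem exists_basis_of_sq_eq (hγ : γ ≠ 0) (x : L)
    (hx : x ^ 2 = algebraMap K L (algebraMap (𝓞 K) K γ))
    (hgen : IntermediateField.adjoin K {x} = ⊤) (hdeg : Module.finrank K L = 2) :
    ∃ b : Module.Basis (Fin 2) K L, b 0 = 1 ∧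
      b 1 ^ 2 = algebraMap K L (4 * algebraMap (𝓞 K) K γ)⁻¹ := by
  have hγ' : algebraMap (𝓞 K) K γ ≠ 0 := by simpa using hγ
  have hxK : x ∉ Set.range (algebraMap K L) := by
    intro h
    have : IntermediateField.adjoin K {x} = ⊥ :=
      IntermediateField.adjoin_simple_eq_bot_iff.2 (IntermediateField.mem_bot.2 h)
    rw [hgen] at this
    have h1 := IntermediateField.finrank_top' (F := K) (E := L)
    rw [this, IntermediateField.finrank_bot, hdeg] at h1
    omega
  set c : K := (2 * algebraMap (𝓞 K) K γ)⁻¹ with hc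
  have hc0 : c ≠ 0 := by simp [hc, hγ]
  have hli : LinearIndependent K ![(1 : L), algebraMap K L c * x] := by
    rw [LinearIndependent.pair_iff]
    intro s t hst
    have ht : t = 0 := by
      by_contra ht
      refine hxK ⟨-s / (t * c), ?_⟩
      have htL : algebraMap K L t ≠ 0 := by simpa using ht
      have hcL : algebraMap K L c ≠ 0 := by simpa using hc0
      simp only [Algebra.smul_def, mul_one] at hst
      simp only [map_div₀, map_neg, map_mul]
      field_simp
      linear_combination -hst
    refine ⟨?_, ht⟩
    simpa [ht] using hst
  refine ⟨basisOfLinearIndependentOfCardEqFinrank hli (by simp [hdeg]), by simp, ?_⟩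
  rw [coe_basisOfLinearIndependentOfCardEqFinrank, Matrix.cons_val_one, Matrix.cons_val_fin_one,
    mul_pow, hx, ← map_pow, ← map_mul, hc]
  congr 1
  field_simp
  norm_num

end RelDisc

/-- **Steinitz class formula for quadratic extensions.**
Let `L = K(√γ)` with `γ𝒪_K = Q·𝔯²·𝔍`, where `Q` is the even part of `γ𝒪_K`, `𝔯²` is the
largest odd square ideal dividing `γ𝒪_K`, and `𝔍` is odd and squarefree; let `𝔏` be the
even part of the relative discriminant `Δ_{L/K}`.  Then the fractional ideal `𝔏/(Q𝔯²)`
is the square of a fractional ideal `a/b`, the square of the Steinitz class equals the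
class of `𝔏/(Q𝔯²)`, and the Steinitz class equals the class of the unique square root
`a/b`. -/
theorem steinitz_formula_quadratic
    (K : Type*) [Field K] [NumberField K]
    (L : Type*) [Field L] [Algebra K L]
    (γ : 𝓞 K) (hγ : γ ≠ 0) (x : L)
    (hx : x ^ 2 = algebraMap K L (algebraMap (𝓞 K) K γ))
    (hgen : IntermediateField.adjoin K {x} = ⊤)
    (hdeg : Module.finrank K L = 2)
    -- the canonical factorization of `γ𝒪_K`
    (Q 𝔯 𝔍 : Ideal (𝓞 K))
    (hfact : Ideal.span {γ} = Q * 𝔯 ^ 2 * 𝔍)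
    (hQ : ∀ p : Ideal (𝓞 K), p.IsPrime → p ∣ Q → p ∣ Ideal.span {(2 : 𝓞 K)})
    (h𝔯 : ∀ p : Ideal (𝓞 K), p.IsPrime → p ∣ 𝔯 → ¬ p ∣ Ideal.span {(2 : 𝓞 K)})
    (h𝔍sf : Squarefree 𝔍)
    (h𝔍 : ∀ p : Ideal (𝓞 K), p.IsPrime → p ∣ 𝔍 → ¬ p ∣ Ideal.span {(2 : 𝓞 K)})
    -- `𝔏` is the even part of the relative discriminant, `F` its odd part
    (𝔏 F : Ideal (𝓞 K))
    (h𝔏F : relDisc K L = 𝔏 * F)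
    (h𝔏 : ∀ p : Ideal (𝓞 K), p.IsPrime → p ∣ 𝔏 → p ∣ Ideal.span {(2 : 𝓞 K)})
    (hF : ∀ p : Ideal (𝓞 K), p.IsPrime → p ∣ F → ¬ p ∣ Ideal.span {(2 : 𝓞 K)}) :
    ∃ a b : (Ideal (𝓞 K))⁰,
      -- `𝔏 / (Q𝔯²) = (a/b)²` as fractional ideals
      𝔏 * (b : Ideal (𝓞 K)) ^ 2 = Q * 𝔯 ^ 2 * (a : Ideal (𝓞 K)) ^ 2 ∧
      -- and the Steinitz class of `L/K` is the class of the square root `a/b`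
      ∀ c : ClassGroup (𝓞 K), IsSteinitzClass K L c →
        c = ClassGroup.mk0 a * (ClassGroup.mk0 b)⁻¹ := by
  obtain ⟨b, h0, h1⟩ := exists_basis_of_sq_eq hγ x hx hgen hdeg
  have hB := coordIdeal_ne_bot b h0 h1 hγ
  have hsq : Q * 𝔯 ^ 2 * 𝔍 * (𝔏 * F) = coordIdeal b ^ 2 := by
    rw [← hfact, ← h𝔏F, span_mul_relDisc_eq_sq b h0 h1 hγ]
  have hne : Q * 𝔯 ^ 2 * 𝔍 * (𝔏 * F) ≠ 0 := by
    rw [hsq]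
    exact pow_ne_zero 2 hB
  have hQr0 : Q * 𝔯 ^ 2 ≠ 0 := left_ne_zero_of_mul (left_ne_zero_of_mul hne)
  have hF0 : F ≠ 0 := right_ne_zero_of_mul (right_ne_zero_of_mul hne)
  have hFsf : Squarefree F := by
    rw [squarefree_iff_irreducible_sq_not_dvd_of_ne_zero hF0]
    intro p hp hpF
    refine hF p (Ideal.isPrime_of_prime hp.prime) (dvd_of_mul_left_dvd hpF)
      (dvd_span_two_of_sq_dvd_relDisc b h0 h1 hγ ?_)
    rw [h𝔏F, sq]
    exact hpF.mul_left 𝔏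
  have hodd {p : Ideal (𝓞 K)} (hp : Prime p) (h2 : ¬ p ∣ Ideal.span {(2 : 𝓞 K)}) :
      ¬ p ∣ Q * 𝔏 := fun h ↦
    have hp' := Ideal.isPrime_of_prime hp
    (hp.dvd_or_dvd h).elim (fun h ↦ h2 (hQ p hp' h)) (fun h ↦ h2 (h𝔏 p hp' h))
  have hFJ : F = 𝔍 := by
    apply dvd_antisymm
    · refine dvd_of_squarefree_of_mul_eq_sq (E := Q * 𝔏) (N := 𝔯) hFsf ?_ hB
        fun p hp hpF ↦ hodd hp (hF p (Ideal.isPrime_of_prime hp) hpF)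
      rw [← hsq]
      ring
    · refine dvd_of_squarefree_of_mul_eq_sq (E := Q * 𝔏) (N := 𝔯) h𝔍sf ?_ hB
        fun p hp hpJ ↦ hodd hp (h𝔍 p (Ideal.isPrime_of_prime hp) hpJ)
      rw [← hsq]
      ring
  subst hFJ
  refine ⟨⟨coordIdeal b, mem_nonZeroDivisors_of_ne_zero hB⟩,
    ⟨Q * 𝔯 ^ 2 * F, mem_nonZeroDivisors_of_ne_zero (mul_ne_zero hQr0 hF0)⟩, ?_, ?_⟩
  · change 𝔏 * (Q * 𝔯 ^ 2 * F) ^ 2 = Q * 𝔯 ^ 2 * coordIdeal b ^ 2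
    rw [← hsq]
    ring
  · rintro _ ⟨I, rfl, ⟨e⟩⟩
    rw [hdeg] at e
    have hone : ClassGroup.mk0 (⟨Q * 𝔯 ^ 2 * F,
        mem_nonZeroDivisors_of_ne_zero (mul_ne_zero hQr0 hF0)⟩ : (Ideal (𝓞 K))⁰) = 1 := by
      rw [ClassGroup.mk0_eq_one_iff]
      exact ⟨γ, hfact.symm⟩
    rw [hone, inv_one, mul_one]
    exact mk0_eq_mk0_coordIdeal b h0 h1 hγ I _ rfl e

end
end
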